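/- Let d = 2^r with an integer r ≥ 2, let c be a nonzero integer, and let f(z) = z^d + 1/c ∈ ℚ[z]. If f is irreducible over ℚ, then f is stable over ℚ, i.e., every iterate fⁿ (n ≥ 1) is irreducible over ℚ. -/

import Mathlib

open Polynomial


theorem irr_comp_sq {F : Type*} [Field F] (G : F[X]) (hm : G.Monic) (hG : Irreducible G)
    (hev : Even G.natDegree) (hs : ¬ IsSquare (G.coeff 0)) : Irreducible (G.comp (X ^ 2)) := by
  refine Polynomial.irreducible_comp hm (monic_X_pow 2) hG ?_
  intro E _ _ x hx
  have hint : IsIntegral F x := by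
    by_contra h
    rw [minpoly.eq_zero h] at hx
    exact hm.ne_zero hx.symm
  rw [Polynomial.map_pow, map_X]
  refine X_pow_sub_C_irreducible_of_prime Nat.prime_two ?_
  intro b hb
  apply hs
  have h1 := IntermediateField.adjoin.powerBasis hint
  have h2 : Algebra.norm F (IntermediateField.AdjoinSimple.gen F x) = G.coeff 0 := by
    have := Algebra.PowerBasis.norm_gen_eq_coeff_zero_minpoly (IntermediateField.adjoin.powerBasis hint)
    rw [IntermediateField.adjoin.powerBasis_gen, IntermediateField.minpoly_gen, hx,
      IntermediateField.adjoin.powerBasis_dim, hx, hev.neg_one_pow, one_mul] at this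
    exact this
  rw [← h2, ← hb, map_pow]
  exact IsSquare.sq _

theorem irr_comp_two_pow {F : Type*} [Field F] (k : ℕ) (G : F[X]) (hm : G.Monic)
    (hG : Irreducible G)
    (hev : Even G.natDegree) (hs : ¬ IsSquare (G.coeff 0)) :
    Irreducible (G.comp (X ^ (2 ^ k))) := by
  induction k generalizing G with
  | zero => simpa using hG
  | succ k ih =>
    have h := ih (G.comp (X ^ 2)) (hm.comp (monic_X_pow 2) (by simp))
      (irr_comp_sq G hm hG hev hs) (by rw [natDegree_comp]; exact hev.mul_right _)
      (by rw [coeff_zero_eq_eval_zero, eval_comp]; simpa [coeff_zero_eq_eval_zero] using hs)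
    rw [comp_assoc] at h
    have e : ((X : F[X]) ^ 2).comp (X ^ 2 ^ k) = X ^ 2 ^ (k + 1) := by
      rw [pow_comp, X_comp, ← pow_mul, pow_succ]
    rwa [e] at h

/-- iterate over the quadratic field -/
theorem iter_irr {F : Type*} [Field F] (r : ℕ) (hr : 2 ≤ r) (γ b : F)
    (h1 : ¬ IsSquare γ) (h2 : ¬ IsSquare (-γ)) (x : ℕ → F) (hx0 : x 0 = b)
    (hxs : ∀ k, x (k + 1) = (x k) ^ (2 ^ r) + b)
    (hns : ∀ k, ¬ IsSquare ((x k) ^ (2 ^ (r - 1)) - γ)) (n : ℕ) :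
    Irreducible (((((X : F[X]) ^ (2 ^ r) + C b).comp ·)^[n] X) ^ (2 ^ (r - 1)) - C γ) := by
  obtain ⟨s, rfl⟩ : ∃ s, r = s + 2 := ⟨r - 2, by omega⟩
  simp only [show s + 2 - 1 = s + 1 by omega] at *
  set f : F[X] := X ^ (2 ^ (s + 2)) + C b with hf
  have hfm : f.Monic := monic_X_pow_add_C _ (by positivity)
  have hfd : f.natDegree = 2 ^ (s + 2) := natDegree_X_pow_add_C
  have hX2 : Irreducible ((X : F[X]) ^ 2 - C γ) := by
    refine X_pow_sub_C_irreducible_of_prime Nat.prime_two ?_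
    intro b hb
    exact h1 (hb ▸ IsSquare.sq b)
  have base : Irreducible ((X : F[X]) ^ (2 ^ (s + 1)) - C γ) := by
    have := irr_comp_two_pow s ((X : F[X]) ^ 2 - C γ) (monic_X_pow_sub_C _ (by norm_num)) hX2
      (by rw [natDegree_X_pow_sub_C]; exact even_two) (by simpa using h2)
    have e : ((X : F[X]) ^ 2 - C γ).comp (X ^ 2 ^ s) = X ^ 2 ^ (s + 1) - C γ := by
      rw [sub_comp, C_comp, pow_comp, X_comp, ← pow_mul, pow_succ]
    rwa [e] at this
  have hcomm : ∀ n, (f.comp ·)^[n + 1] X = ((f.comp ·)^[n] X).comp f := by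
    intro n
    induction n with
    | zero => simp
    | succ n ih =>
      have h3 : (f.comp ·)^[n + 1] X = f.comp ((f.comp ·)^[n] X) :=
        Function.iterate_succ_apply' _ _ _
      rw [Function.iterate_succ_apply', ih, ← comp_assoc, ← h3, ih]
  have hmon : ∀ n, ((f.comp ·)^[n] X).Monic := by
    intro n
    induction n with
    | zero => simp
    | succ n ih =>
      rw [hcomm]
      exact ih.comp hfm (by rw [hfd]; positivity)
  have hdeg : ∀ n, ((f.comp ·)^[n] X).natDegree = (2 ^ (s + 2)) ^ n := by
    intro n
    induction n with
    | zero => simp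
    | succ n ih => rw [hcomm, natDegree_comp, ih, hfd, ← pow_succ]
  have hev : ∀ n, ((f.comp ·)^[n] X).eval b = x n := by
    intro n
    induction n with
    | zero => simp [hx0]
    | succ n ih => rw [Function.iterate_succ_apply', eval_comp, ih, hxs, hf]; simp
  induction n with
  | zero => simpa using base
  | succ n ih =>
    set P := (f.comp ·)^[n] X with hP
    set g := P ^ (2 ^ (s + 1)) - C γ with hg
    have hgd : g.natDegree = (2 ^ (s + 2)) ^ n * 2 ^ (s + 1) := by
      rw [hg, natDegree_sub_C, natDegree_pow, hP, hdeg, mul_comm]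
    have hgm : g.Monic := by
      have : (P ^ (2 ^ (s + 1))).Monic := (hmon n).pow _
      refine this.sub_of_left ?_
      refine lt_of_le_of_lt degree_C_le ?_
      rw [← natDegree_pos_iff_degree_pos, natDegree_pow, hP, hdeg]
      positivity
    have e1 : ((f.comp ·)^[n + 1] X) ^ (2 ^ (s + 1)) - C γ
        = (g.comp (X + C b)).comp (X ^ (2 ^ (s + 2))) := by
      rw [hcomm, comp_assoc, hg, sub_comp, pow_comp, C_comp, add_comp, X_comp, C_comp]
    rw [e1]
    refine irr_comp_two_pow (s + 2) _ (hgm.comp_X_add_C b) ?_ ?_ ?_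
    · have := (MulEquiv.irreducible_iff (Polynomial.algEquivAevalXAddC b) (x := g)).2 ih
      simpa [algEquivAevalXAddC_apply, aeval_def, comp, eval₂_eq_eval_map] using this
    · rw [natDegree_comp, natDegree_X_add_C, hgd, mul_one]
      exact (Nat.even_pow.2 ⟨even_two, by omega⟩).mul_left _
    · rw [coeff_zero_eq_eval_zero, eval_comp]
      simp only [eval_add, eval_X, eval_C, zero_add, hg, eval_sub, eval_pow]
      rw [hP, hev]
      exact hns n

theorem quad_rep {K : Type*} [Field K] {E : Type*} [Field E] [Algebra K E] (x : E) (b : K)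
    (hx : minpoly K x = X ^ 2 + C b) (y : IntermediateField.adjoin K {x}) :
    ∃ u v : K, y = algebraMap K _ u + algebraMap K _ v * IntermediateField.AdjoinSimple.gen K x := by
  have hint : IsIntegral K x := by
    by_contra h
    rw [minpoly.eq_zero h] at hx
    exact (monic_X_pow_add_C b (two_ne_zero)).ne_zero hx.symm
  obtain ⟨g, hg, hy⟩ := (IntermediateField.adjoin.powerBasis hint).exists_eq_aeval y
  rw [IntermediateField.adjoin.powerBasis_dim, hx, natDegree_X_pow_add_C] at hg
  rw [IntermediateField.adjoin.powerBasis_gen] at hy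
  refine ⟨g.coeff 0, g.coeff 1, ?_⟩
  rw [hy]
  conv_lhs => rw [Polynomial.eq_X_add_C_of_natDegree_le_one (Nat.lt_succ_iff.1 hg)]
  simp [add_comm]

theorem quad_sq {K : Type*} [Field K] {E : Type*} [Field E] [Algebra K E] (x : E) (b : K)
    (hx : minpoly K x = X ^ 2 + C b) (a a' : K)
    (h : IsSquare (algebraMap K (IntermediateField.adjoin K {x}) a +
      algebraMap K _ a' * IntermediateField.AdjoinSimple.gen K x)) :
    ∃ u v : K, u ^ 2 - b * v ^ 2 = a ∧ 2 * u * v = a' := by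
  have hint : IsIntegral K x := by
    by_contra h
    rw [minpoly.eq_zero h] at hx
    exact (monic_X_pow_add_C b (two_ne_zero)).ne_zero hx.symm
  obtain ⟨y, hy⟩ := h
  obtain ⟨u, v, rfl⟩ := quad_rep x b hx y
  set γ := IntermediateField.AdjoinSimple.gen K x with hγ
  have hmin : minpoly K γ = X ^ 2 + C b := by rw [hγ, IntermediateField.minpoly_gen, hx]
  have hsq : γ ^ 2 = - algebraMap K _ b := by
    have := minpoly.aeval K γ
    rw [hmin] at this
    simp at this
    linear_combination this
  have hlin : ∀ s t : K, algebraMap K _ s + algebraMap K _ t * γ = 0 → s = 0 ∧ t = 0 := by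
    intro s t hst
    by_contra hne
    have hp : (C t * X + C s : K[X]) ≠ 0 := by
      intro h0
      apply hne
      have h1 := congrArg (fun p => coeff p 0) h0
      have h2 := congrArg (fun p => coeff p 1) h0
      simp at h1 h2
      exact ⟨h1, h2⟩
    have := natDegree_le_of_dvd (minpoly.dvd K γ (p := C t * X + C s)
      (by simp; linear_combination hst)) hp
    rw [hmin, natDegree_X_pow_add_C] at this
    have h2 : (C t * X + C s : K[X]).natDegree ≤ 1 := natDegree_linear_le
    omega
  have := hlin (u ^ 2 - b * v ^ 2 - a) (2 * u * v - a') (by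
    simp only [map_sub, map_mul, map_pow, map_ofNat]
    linear_combination -hy - (algebraMap K _ v) ^ 2 * hsq)
  exact ⟨u, v, by linear_combination this.1, by linear_combination this.2⟩

theorem reduction {K : Type*} [Field K] [CharZero K] (r : ℕ) (hr : 2 ≤ r) (b : K) (hb : b ≠ 0)
    (hirr : Irreducible ((X : K[X]) ^ (2 ^ r) + C b)) (x : ℕ → K) (hx0 : x 0 = b)
    (hxs : ∀ k, x (k + 1) = (x k) ^ (2 ^ r) + b)
    (hcore : ∀ k, ∀ u v : K, 2 * u * v = -1 → u ^ 2 - b * v ^ 2 = (x k) ^ (2 ^ (r - 1)) → False)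
    (n : ℕ) : Irreducible ((((X : K[X]) ^ (2 ^ r) + C b).comp ·)^[n + 1] X) := by
  have hpr : (2 : ℕ) ^ r = 2 ^ (r - 1) * 2 := by rw [← pow_succ]; congr 1; omega
  have hpr2 : (2 : ℕ) ^ (r - 1) = 2 ^ (r - 2) * 2 := by rw [← pow_succ]; congr 1; omega
  have hnf : ∀ A B : K[X], 0 < A.natDegree → 0 < B.natDegree →
      (X : K[X]) ^ (2 ^ r) + C b ≠ A * B := by
    intro A B hA hB h
    rcases hirr.isUnit_or_isUnit h with h | h
    · have := natDegree_eq_zero_of_isUnit h; omega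
    · have := natDegree_eq_zero_of_isUnit h; omega
  have hPirr : Irreducible ((X : K[X]) ^ 2 + C b) := by
    have : (X : K[X]) ^ 2 + C b = X ^ 2 - C (-b) := by simp
    rw [this]
    refine X_pow_sub_C_irreducible_of_prime Nat.prime_two ?_
    intro t ht
    refine hnf (X ^ (2 ^ (r - 1)) - C t) (X ^ (2 ^ (r - 1)) + C t) ?_ ?_ ?_
    · rw [natDegree_X_pow_sub_C]; positivity
    · rw [natDegree_X_pow_add_C]; positivity
    · have : b = - t ^ 2 := by linear_combination ht
      rw [this, hpr, pow_mul]
      simp only [C_neg, C_pow]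
      ring
  have h4 : ∀ u : K, b ≠ 4 * u ^ 4 := by
    intro u hu
    have key : ∀ u : K, 0 < ((X : K[X]) ^ (2 ^ (r - 1)) + C (2 * u) * X ^ (2 ^ (r - 2)) + C (2 * u ^ 2)).natDegree := by
      intro u
      have hlt : (2 : ℕ) ^ (r - 2) < 2 ^ (r - 1) := Nat.pow_lt_pow_right (by norm_num) (by omega)
      have : 2 ^ (r - 1) ≤ ((X : K[X]) ^ (2 ^ (r - 1)) + C (2 * u) * X ^ (2 ^ (r - 2)) + C (2 * u ^ 2)).natDegree := by
        apply le_natDegree_of_ne_zero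
        rw [coeff_add, coeff_add, coeff_X_pow, coeff_C_mul, coeff_X_pow, coeff_C]
        simp [hlt.ne']
      exact lt_of_lt_of_le (by positivity) this
    refine hnf _ _ (key u) (key (-u)) ?_
    rw [hu, hpr, hpr2, pow_mul, pow_mul]
    simp only [C_mul, C_pow, C_neg]
    have h44 : (C 4 : K[X]) = 4 := map_ofNat C 4
    have h22 : (C 2 : K[X]) = 2 := map_ofNat C 2
    rw [h44, h22]
    ring
  have e1 : (((X : K[X]) ^ (2 ^ r) + C b).comp ·)^[n + 1] X
      = (X ^ 2 + C b).comp (((((X : K[X]) ^ (2 ^ r) + C b).comp ·)^[n] X) ^ (2 ^ (r - 1))) := by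
    rw [Function.iterate_succ_apply']
    simp only [add_comp, pow_comp, X_comp, C_comp]
    rw [← pow_mul, hpr]
  rw [e1]
  have hmon : ∀ n, ((((X : K[X]) ^ (2 ^ r) + C b).comp ·)^[n] X).Monic ∧
      0 < ((((X : K[X]) ^ (2 ^ r) + C b).comp ·)^[n] X).natDegree := by
    intro n
    induction n with
    | zero => simp
    | succ n ih =>
      rw [Function.iterate_succ_apply']
      refine ⟨(monic_X_pow_add_C _ (by positivity)).comp ih.1 ih.2.ne', ?_⟩
      rw [natDegree_comp, natDegree_X_pow_add_C]
      have := ih.2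
      positivity
  refine Polynomial.irreducible_comp (monic_X_pow_add_C _ two_ne_zero) ((hmon n).1.pow _) hPirr ?_
  intro E _ _ z hz
  have hmap : ∀ n, ((((X : K[X]) ^ (2 ^ r) + C b).comp ·)^[n] X).map
      (algebraMap K (IntermediateField.adjoin K {z}))
      = ((((X : (IntermediateField.adjoin K {z})[X]) ^ (2 ^ r) + C (algebraMap K _ b)).comp ·)^[n] X) := by
    intro n
    induction n with
    | zero => simp
    | succ n ih =>
      rw [Function.iterate_succ_apply', Function.iterate_succ_apply', map_comp, ih]
      simp
  rw [Polynomial.map_pow, hmap]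
  refine iter_irr r hr _ _ ?_ ?_ (fun k => algebraMap K _ (x k)) (by simp [hx0]) ?_ ?_ n
  · intro h
    obtain ⟨u, v, h1, h2⟩ := quad_sq z b hz 0 1 (by simpa using h)
    have hv : v ≠ 0 := by rintro rfl; simp at h2
    apply h4 u
    have : v = 1 / (2 * u) := by
      have : u ≠ 0 := by rintro rfl; simp at h2
      field_simp; linear_combination h2
    have hu : u ≠ 0 := by rintro rfl; simp at h2
    rw [this] at h1
    field_simp at h1
    linear_combination -h1
  · intro h
    obtain ⟨u, v, h1, h2⟩ := quad_sq z b hz 0 (-1) (by simpa using h)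
    have hu : u ≠ 0 := by rintro rfl; simp at h2
    apply h4 u
    have : v = -1 / (2 * u) := by
      field_simp; linear_combination h2
    rw [this] at h1
    field_simp at h1
    linear_combination -h1
  · intro k
    simp [hxs]
  · intro k h
    obtain ⟨u, v, h1, h2⟩ := quad_sq z b hz ((x k) ^ (2 ^ (r - 1))) (-1)
      (by simpa [sub_eq_add_neg] using h)
    exact hcore k u v h2 h1


theorem coprime_split {a b c e : ℕ} (h : Nat.Coprime a b) (hab : a * b = c ^ e) :
    ∃ s t, a = s ^ e ∧ b = t ^ e := by
  obtain ⟨s, hs⟩ := exists_eq_pow_of_mul_eq_pow (by rw [Nat.isUnit_iff]; exact h) hab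
  obtain ⟨t, ht⟩ := exists_eq_pow_of_mul_eq_pow (by rw [Nat.isUnit_iff]; exact h.symm)
    ((mul_comm b a).trans hab)
  exact ⟨s, t, hs, ht⟩

theorem sq_eq_odd_pow {a s e : ℕ} (he : Odd e) (h : a ^ 2 = s ^ e) :
    ∃ τ, a = τ ^ e ∧ s = τ ^ 2 :=
  Nat.exists_eq_pow_of_exponent_coprime_of_pow_eq_pow
    (by rw [Nat.coprime_two_left]; exact he) h

theorem even_final (Y q c w E : ℕ) (hY : 0 < Y) (hq2 : 2 ≤ q) (h2w : Y ≤ 2 * w)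
    (hb : w ^ 4 * c ^ 3 ≤ 2 * E) (hce : E ≤ 4 * (Y * q) ^ 4) (hc : (q + 1) ^ 2 * q ≤ c) :
    False := by
  have h10 : Y ^ 4 * c ^ 3 ≤ Y ^ 4 * (128 * q ^ 4) := by
    have h1 : Y ^ 4 * c ^ 3 ≤ (2 * w) ^ 4 * c ^ 3 :=
      Nat.mul_le_mul_right _ (Nat.pow_le_pow_left h2w 4)
    have h2 : (2 * w) ^ 4 * c ^ 3 = 16 * (w ^ 4 * c ^ 3) := by ring
    have h3 : 128 * (Y * q) ^ 4 = Y ^ 4 * (128 * q ^ 4) := by ring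
    omega
  have h11 : c ^ 3 ≤ 128 * q ^ 4 := Nat.le_of_mul_le_mul_left h10 (by positivity)
  have h12 : ((q + 1) ^ 2 * q) ^ 3 ≤ c ^ 3 := Nat.pow_le_pow_left hc 3
  have h13 : 128 * q ^ 4 < ((q + 1) ^ 2 * q) ^ 3 := by
    have h5 : 3 ^ 5 ≤ (q + 1) ^ 5 := Nat.pow_le_pow_left (by omega) 5
    have h6 : 3 ^ 5 * ((q + 1) * q ^ 3) ≤ (q + 1) ^ 5 * ((q + 1) * q ^ 3) :=
      Nat.mul_le_mul_right _ h5
    have h7 : (q + 1) ^ 5 * ((q + 1) * q ^ 3) = ((q + 1) ^ 2 * q) ^ 3 := by ring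
    have h8 : (q + 1) * q ^ 3 = q ^ 4 + q ^ 3 := by ring
    have h9 : 0 < q ^ 3 := by positivity
    norm_num at h6
    omega
  omega

/-- The case `U` even. -/
theorem even_case (U w c e : ℕ) (he : Odd e) (he3 : 3 ≤ e) (hw : 1 ≤ w) (hwU : w < U)
    (hco : Nat.Coprime w c) (hU : Even U)
    (heq : 4 * U ^ 2 * ((U - w) * (U + w)) = c ^ e)
    (hb : 4 ≤ c → w ^ 4 * c ^ 3 ≤ 2 * c ^ e) : False := by
  have he0 : e ≠ 0 := by omega
  obtain ⟨j, rfl⟩ : ∃ j, U = w + j := ⟨U - w, by omega⟩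
  have hcU : Nat.Coprime w (w + j) := by
    have : Nat.Coprime w (c ^ e) := Nat.Coprime.pow_right e hco
    rw [← heq] at this
    exact Nat.Coprime.coprime_dvd_right ⟨4 * (w + j) * ((w + j - w) * (w + j + w)), by ring⟩ this
  have hw2 : Nat.Coprime w 2 := by
    have : Nat.Coprime w (c ^ e) := Nat.Coprime.pow_right e hco
    rw [← heq] at this
    exact Nat.Coprime.coprime_dvd_right ⟨2 * (w + j) ^ 2 * ((w + j - w) * (w + j + w)), by ring⟩ this
  have hwodd : Odd w := Nat.coprime_two_right.1 hw2
  have hsub : w + j - w = j := by omega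
  rw [hsub] at heq
  have hjodd : Odd j := by
    rcases Nat.even_or_odd j with h | h
    · exact absurd hU (Nat.not_even_iff_odd.2 (hwodd.add_even h))
    · exact h
  have hjw : Nat.Coprime j w := by
    have := hcU
    rw [Nat.coprime_self_add_right] at this
    exact this.symm
  have hj2 : Nat.Coprime j 2 := Nat.coprime_two_right.2 hjodd
  have hjU : Nat.Coprime j (w + j) := by simpa using hjw
  have hk2 : Nat.Coprime (w + j + w) 2 :=
    Nat.coprime_two_right.2 (hU.add_odd hwodd)
  have hkU : Nat.Coprime (w + j + w) (w + j) := by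
    rw [show w + j + w = w + (w + j) by ring, Nat.coprime_add_self_left]
    exact hcU
  have hjk : Nat.Coprime j (w + j + w) := by
    have : w + j + w = 2 * w + j := by ring
    rw [this, Nat.coprime_add_self_right]
    exact hj2.mul_right hjw
  have h1 : Nat.Coprime ((2 * (w + j)) ^ 2) (j * (w + j + w)) := by
    apply Nat.Coprime.pow_left
    apply Nat.Coprime.mul_left
    · exact (hj2.mul_left hk2).symm
    · exact (hjU.mul_left hkU).symm
  obtain ⟨s, t, hs, ht⟩ := coprime_split h1 (c := c) (e := e) (by rw [← heq]; ring)
  obtain ⟨τ, hτ, hsτ⟩ := sq_eq_odd_pow he hs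
  obtain ⟨p, q, hp, hq⟩ := coprime_split hjk ht
  have hceq : c = τ ^ 2 * (p * q) := by
    apply Nat.pow_left_injective he0
    simp only
    rw [← heq, mul_pow, mul_pow, ← hp, ← hq, ← pow_mul, mul_comm 2 e, pow_mul, ← hτ]
    ring
  have hpq : p < q := by
    apply lt_of_pow_lt_pow_left₀ e (by omega)
    rw [← hp, ← hq]; omega
  have hp1 : 1 ≤ p := by
    rcases Nat.eq_zero_or_pos p with h | h
    · rw [h, zero_pow he0] at hp; omega
    · exact h
  have hqτ : q < τ := by
    apply lt_of_pow_lt_pow_left₀ e (by omega)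
    rw [← hτ, ← hq]; omega
  have hc : (q + 1) ^ 2 * q ≤ c := by
    rw [hceq]
    calc (q + 1) ^ 2 * q ≤ τ ^ 2 * (1 * q) := by rw [one_mul]; gcongr; omega
      _ ≤ _ := by gcongr
  have hq2 : 2 ≤ q := by omega
  have hc4 : 4 ≤ c := by nlinarith
  have hb := hb hc4
  have h2w : q ^ (e - 1) ≤ 2 * w := by
    obtain ⟨i, rfl⟩ : ∃ i, e = i + 1 := ⟨e - 1, by omega⟩
    simp only [Nat.add_sub_cancel]
    have h3 : p ^ i ≤ q ^ i := Nat.pow_le_pow_left hpq.le _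
    have h4 : p ^ (i + 1) = p ^ i * p := pow_succ _ _
    have h5 : q ^ (i + 1) = q ^ i * q := pow_succ _ _
    have h6 : q ^ i * (p + 1) ≤ q ^ i * q := by gcongr; omega
    have h7 : p ^ i * p ≤ q ^ i * p := by gcongr
    have h8 : q ^ i * (p + 1) = q ^ i * p + q ^ i := by ring
    omega
  have hce : c ^ e ≤ 4 * (q ^ e) ^ 4 := by
    rw [← heq, ← hq]
    have h3 : (w + j) ^ 2 ≤ (w + j + w) ^ 2 := Nat.pow_le_pow_left (by omega) 2
    have h4 : j * (w + j + w) ≤ (w + j + w) * (w + j + w) := Nat.mul_le_mul_right _ (by omega)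
    have h5 := Nat.mul_le_mul (Nat.mul_le_mul_left 4 h3) h4
    calc _ ≤ _ := h5
      _ = _ := by ring
  have h9 : q ^ e = q ^ (e - 1) * q := by rw [← pow_succ]; congr 1; omega
  have hpos : 0 < q ^ (e - 1) := by positivity
  rw [h9] at hce
  exact even_final _ q c w (c ^ e) hpos hq2 h2w hb hce hc

/-- The case `U` odd. -/
theorem odd_case (U w c e : ℕ) (he : Odd e) (he3 : 3 ≤ e) (hw : 1 ≤ w) (hwU : w < U)
    (hco : Nat.Coprime w c) (hU : Odd U)
    (heq : 4 * U ^ 2 * ((U - w) * (U + w)) = c ^ e) :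
    ∃ σ p Q : ℕ, ∃ z : ℤ, Odd σ ∧ 3 ≤ σ ∧ 1 ≤ p ∧ 1 ≤ Q ∧ Even Q ∧ c = σ ^ 2 * (p * Q) ∧ z ^ 2 = (w : ℤ) ^ 2 ∧
      |z| < (σ : ℤ) ^ e ∧
      2 * (p : ℤ) ^ e = σ ^ e + z ∧ (Q : ℤ) ^ e = 8 * (σ ^ e - z) := by
  have he0 : e ≠ 0 := by omega
  have hcwe : Nat.Coprime w (c ^ e) := Nat.Coprime.pow_right e hco
  rw [← heq] at hcwe
  have hcU : Nat.Coprime w U :=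
    Nat.Coprime.coprime_dvd_right ⟨4 * U * ((U - w) * (U + w)), by ring⟩ hcwe
  have hw2 : Nat.Coprime w 2 :=
    Nat.Coprime.coprime_dvd_right ⟨2 * U ^ 2 * ((U - w) * (U + w)), by ring⟩ hcwe
  have hwodd : Odd w := Nat.coprime_two_right.1 hw2
  obtain ⟨m, hm⟩ : ∃ m, U - w = 2 * m := by
    obtain ⟨a, ha⟩ := hU
    obtain ⟨b, hb⟩ := hwodd
    exact ⟨a - b, by omega⟩
  obtain ⟨l, hl⟩ : ∃ l, U + w = 2 * l := by
    obtain ⟨a, ha⟩ := hU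
    obtain ⟨b, hb⟩ := hwodd
    exact ⟨a + b + 1, by omega⟩
  have hUml : U = m + l := by omega
  have hwml : l = w + m := by omega
  rw [hm, hl] at heq
  have hmw : Nat.Coprime m w := by
    have : U = m * 2 + w := by omega
    rw [this] at hcU
    rw [Nat.coprime_add_self_right] at hcU
    exact (Nat.Coprime.coprime_dvd_right ⟨2, rfl⟩ hcU).symm
  have hml : Nat.Coprime m l := by rw [hwml, Nat.coprime_add_self_right]; exact hmw
  have hU2 : Nat.Coprime U 2 := Nat.coprime_two_right.2 hU
  have hUm : Nat.Coprime U m := by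
    rw [hUml]; simpa using hml.symm
  have hUl : Nat.Coprime U l := by
    rw [hUml]; simpa using hml
  have hU16 : Nat.Coprime U 16 := by
    have : (16 : ℕ) = 2 ^ 4 := by norm_num
    rw [this]; exact hU2.pow_right 4
  have h1 : Nat.Coprime (U ^ 2) (16 * (m * l)) :=
    Nat.Coprime.pow_left 2 (hU16.mul_right (hUm.mul_right hUl))
  obtain ⟨s, T, hs, hT⟩ := coprime_split h1 (c := c) (e := e) (by rw [← heq]; ring)
  obtain ⟨σ, hσ, hsσ⟩ := sq_eq_odd_pow he hs
  have hσodd : Odd σ := by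
    rw [hσ] at hU
    exact (Nat.odd_pow_iff he0).1 hU
  have hσ3 : 3 ≤ σ := by
    have h0 : σ ≠ 1 := by rintro rfl; simp at hσ; omega
    have h2 : σ ≠ 0 := by rintro rfl; simp at hσodd
    obtain ⟨k, hk⟩ := hσodd
    omega
  have hlpos : 0 < l := by omega
  have hmpos : 0 < m := by omega
  have key : ∀ x y : ℕ, 0 < x → 0 < y → Odd x → Nat.Coprime x y → x * y = m * l →
      ∃ p Q : ℕ, x = p ^ e ∧ 16 * y = Q ^ e ∧ 1 ≤ p ∧ 1 ≤ Q ∧ Even Q ∧ c = σ ^ 2 * (p * Q) := by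
    intro x y hx hy hxo hxy hxyml
    have h16 : Nat.Coprime x 16 := by
      have : (16 : ℕ) = 2 ^ 4 := by norm_num
      rw [this]; exact (Nat.coprime_two_right.2 hxo).pow_right 4
    obtain ⟨p, Q, hp, hQ⟩ := coprime_split (h16.mul_right hxy) (c := T) (e := e)
      (by rw [← hT, ← hxyml]; ring)
    refine ⟨p, Q, hp, hQ, ?_, ?_, ?_, ?_⟩
    · rcases Nat.eq_zero_or_pos p with h | h
      · rw [h, zero_pow he0] at hp; omega
      · exact h
    · rcases Nat.eq_zero_or_pos Q with h | h
      · rw [h, zero_pow he0] at hQ; omega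
      · exact h
    · have : Even (Q ^ e) := by rw [← hQ]; exact ⟨8 * y, by ring⟩
      exact (Nat.even_pow.1 this).1
    · apply Nat.pow_left_injective he0
      simp only
      rw [← heq, mul_pow, mul_pow, ← hp, ← hQ, ← pow_mul, mul_comm 2 e, pow_mul, ← hσ]
      calc _ = 16 * U ^ 2 * (m * l) := by ring
        _ = _ := by rw [← hxyml]; ring
  have hσz : (σ : ℤ) ^ e = U := by rw [hσ]; push_cast; rfl
  rcases Nat.even_or_odd m with hme | hmo
  · have hlo : Odd l := by rw [hwml]; exact hwodd.add_even hme
    obtain ⟨p, Q, hp, hQ, hp1, hQ1, hQe, hc⟩ := key l m hlpos hmpos hlo hml.symm (mul_comm _ _)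
    refine ⟨σ, p, Q, w, hσodd, hσ3, hp1, hQ1, hQe, hc, rfl, ?_, ?_, ?_⟩
    · rw [hσz, abs_of_nonneg (by positivity)]; exact_mod_cast hwU
    · rw [hσz]; zify at hp hl; linarith
    · rw [hσz]; zify at hQ hwml hUml; linarith
  · obtain ⟨p, Q, hp, hQ, hp1, hQ1, hQe, hc⟩ := key m l hmpos hlpos hmo hml rfl
    refine ⟨σ, p, Q, -w, hσodd, hσ3, hp1, hQ1, hQe, hc, by ring, ?_, ?_, ?_⟩
    · rw [hσz, abs_neg, abs_of_nonneg (by positivity)]; exact_mod_cast hwU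
    · rw [hσz]; zify at hp hwml hUml; linarith
    · rw [hσz]; zify at hQ hwml hUml; linarith

set_option maxHeartbeats 4000000 in
theorem ana1 (e : ℕ) (he : 15 ≤ e) (u ρ : ℝ) (hu : |u| ≤ 1 / 1000) (hρ : 0 < 1 + ρ)
    (h : (1 + ρ) ^ e = 1 + 2 * u - 2 * u ^ 3 - u ^ 4) :
    |e * ρ - (2 * u - 2 * u ^ 2 + 2 * u ^ 2 / e)| ≤ 11 * |u| ^ 3 := by
  have heR : (15 : ℝ) ≤ e := by exact_mod_cast he
  have he0 : (0 : ℝ) < e := by linarith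
  set a := |u| with ha
  have ha0 : 0 ≤ a := abs_nonneg u
  have hua : u ^ 2 = a ^ 2 := (sq_abs u).symm
  have hua4 : u ^ 4 = a ^ 4 := by
    have : u ^ 4 = (u ^ 2) ^ 2 := by ring
    rw [this, hua]; ring
  have hu3 : |u ^ 3| = a ^ 3 := by rw [abs_pow]
  have ha3 : 0 ≤ a ^ 3 := by positivity
  have ha2 : 0 ≤ a ^ 2 := by positivity
  have ha43 : a ^ 4 ≤ a ^ 3 / 1000 := by
    have : a ^ 4 = a ^ 3 * a := by ring
    rw [this]; nlinarith
  have ha32 : a ^ 3 ≤ a ^ 2 / 1000 := by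
    have : a ^ 3 = a ^ 2 * a := by ring
    rw [this]; nlinarith
  have ha21 : a ^ 2 ≤ a / 1000 := by nlinarith
  set v := 2 * u - 2 * u ^ 3 - u ^ 4 with hv
  have hv2u : |v - 2 * u| ≤ 2.001 * a ^ 3 := by
    have : v - 2 * u = -(2 * u ^ 3 + a ^ 4) := by rw [hv, ← hua4]; ring
    rw [this, abs_neg]
    have h1 := abs_add_le (2 * u ^ 3) (a ^ 4)
    rw [abs_mul, hu3, abs_two, abs_of_nonneg (by positivity : 0 ≤ a ^ 4)] at h1
    linarith
  have h2u : |2 * u| = 2 * a := by rw [abs_mul, abs_two]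
  have hvabs : |v| ≤ 2.01 * a := by
    have h1 := abs_add_le (v - 2 * u) (2 * u)
    rw [sub_add_cancel, h2u] at h1
    linarith
  have hvabs' : |v| ≤ 0.00201 := by linarith
  have hlog := Real.abs_log_sub_add_sum_range_le (x := -v) (by rw [abs_neg]; linarith) 2
  simp only [Finset.sum_range_succ, Finset.sum_range_zero, abs_neg, sub_neg_eq_add] at hlog
  norm_num at hlog
  set L := Real.log (1 + v) with hL
  have hv3 : |v| ^ 3 / (1 - |v|) ≤ 8.2 * a ^ 3 := by
    rw [div_le_iff₀ (by linarith)]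
    have h1 : |v| ^ 3 ≤ (2.01 * a) ^ 3 := by gcongr
    have h2 : (2.01 * a) ^ 3 = 8.120601 * a ^ 3 := by ring
    nlinarith
  have hL1 : |L - (2 * u - 2 * u ^ 2)| ≤ 10.3 * a ^ 3 := by
    have h3 : |(v ^ 2 / 2 - 2 * u ^ 2)| ≤ 0.01 * a ^ 3 := by
      have h4 : v ^ 2 / 2 - 2 * u ^ 2 = (v - 2 * u) * ((v + 2 * u) / 2) := by ring
      rw [h4, abs_mul]
      have h5 : |(v + 2 * u) / 2| ≤ 2.1 * a := by
        rw [abs_div, abs_two]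
        have := abs_add_le v (2 * u)
        rw [h2u] at this
        linarith
      calc _ ≤ (2.001 * a ^ 3) * (2.1 * a) := by gcongr
        _ ≤ 0.01 * a ^ 3 := by
          have : (2.001 * a ^ 3) * (2.1 * a) = 4.2021 * a ^ 4 := by ring
          rw [this]; linarith
    have h6 : L - (2 * u - 2 * u ^ 2) = (-v + v ^ 2 / 2 + L) + (v - 2 * u) - (v ^ 2 / 2 - 2 * u ^ 2) := by
      ring
    rw [h6]
    have h7 := abs_sub ((-v + v ^ 2 / 2 + L) + (v - 2 * u)) (v ^ 2 / 2 - 2 * u ^ 2)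
    have h8 := abs_add_le (-v + v ^ 2 / 2 + L) (v - 2 * u)
    linarith
  have hL2 : |L - 2 * u| ≤ 2.02 * a ^ 2 := by
    have h1 : L - 2 * u = (L - (2 * u - 2 * u ^ 2)) + (- (2 * a ^ 2)) := by rw [hua]; ring
    rw [h1]
    have := abs_add_le (L - (2 * u - 2 * u ^ 2)) (- (2 * a ^ 2))
    rw [abs_neg, abs_of_nonneg (by positivity : 0 ≤ 2 * a ^ 2)] at this
    linarith
  have hLabs : |L| ≤ 2.01 * a := by
    have h1 := abs_add_le (L - 2 * u) (2 * u)
    rw [sub_add_cancel, h2u] at h1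
    linarith
  have hLsq : |L ^ 2 - 4 * u ^ 2| ≤ 8.2 * a ^ 3 := by
    have h1 : L ^ 2 - 4 * u ^ 2 = (L - 2 * u) * (L + 2 * u) := by ring
    rw [h1, abs_mul]
    have h2 : |L + 2 * u| ≤ 4.01 * a := by
      have := abs_add_le L (2 * u)
      rw [h2u] at this
      linarith
    calc _ ≤ (2.02 * a ^ 2) * (4.01 * a) := by gcongr
      _ = 8.1002 * a ^ 3 := by ring
      _ ≤ _ := by linarith
  have hLe : e * Real.log (1 + ρ) = L := by
    rw [hL, hv, ← Real.log_pow, h]; congr 1; ring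
  set t := Real.log (1 + ρ) with ht
  have hρt : ρ = Real.exp t - 1 := by rw [ht, Real.exp_log hρ]; ring
  have htL : |t| = |L| / e := by
    rw [← hLe, abs_mul, abs_of_pos he0]; field_simp
  have ht1 : |t| ≤ 1 := by
    rw [htL, div_le_one he0]; linarith
  have hexp := Real.exp_bound ht1 (n := 3) (by norm_num)
  simp only [Finset.sum_range_succ, Finset.sum_range_zero] at hexp
  norm_num [Nat.factorial] at hexp
  have hfin : e * ρ - (2 * u - 2 * u ^ 2 + 2 * u ^ 2 / e)
      = e * (Real.exp t - (1 + t + t ^ 2 / 2)) + (L - (2 * u - 2 * u ^ 2))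
        + (L ^ 2 - 4 * u ^ 2) / (2 * e) := by
    rw [hρt, ← hLe]; field_simp; ring
  rw [hfin]
  have h1 := abs_add_le (e * (Real.exp t - (1 + t + t ^ 2 / 2)) + (L - (2 * u - 2 * u ^ 2))) ((L ^ 2 - 4 * u ^ 2) / (2 * e))
  have h2 := abs_add_le (e * (Real.exp t - (1 + t + t ^ 2 / 2))) (L - (2 * u - 2 * u ^ 2))
  have h3 : |(L ^ 2 - 4 * u ^ 2) / (2 * e)| ≤ 0.3 * a ^ 3 := by
    rw [abs_div, abs_of_pos (by positivity : (0 : ℝ) < 2 * e), div_le_iff₀ (by positivity)]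
    nlinarith
  have h4 : |e * (Real.exp t - (1 + t + t ^ 2 / 2))| ≤ 0.1 * a ^ 3 := by
    rw [abs_mul, abs_of_pos he0]
    have h5 : e * |t| ^ 3 ≤ 0.1 * a ^ 3 := by
      rw [htL, div_pow]
      have h6 : |L| ^ 3 ≤ (2.01 * a) ^ 3 := by gcongr
      have h7 : (e : ℝ) * (|L| ^ 3 / e ^ 3) = |L| ^ 3 / e ^ 2 := by field_simp
      rw [h7, div_le_iff₀ (by positivity)]
      have h8 : (2.01 * a) ^ 3 = 8.120601 * a ^ 3 := by ring
      have h9 : (225 : ℝ) ≤ e ^ 2 := by nlinarith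
      have h11 := mul_le_mul_of_nonneg_left h9 ha3
      linarith
    have h10 : |Real.exp t - (1 + t + t ^ 2 / 2)| ≤ |t| ^ 3 := by
      have : 0 ≤ |t| ^ 3 := by positivity
      linarith
    calc _ ≤ e * |t| ^ 3 := by gcongr
      _ ≤ _ := h5
  linarith



theorem mulb (x y a b : ℝ) (hx : |x| ≤ a) (hy : |y| ≤ b) : |x * y| ≤ a * b := by
  rw [abs_mul]
  exact mul_le_mul hx hy (abs_nonneg _) ((abs_nonneg _).trans hx)

theorem anaA (a s : ℝ) (ha1 : -1/15000 ≤ a) (ha2 : a ≤ 1/15000) (has : a^2 ≤ s/225) (hs : 0 < s)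
    (hs1 : s ≤ 1/1000000) : 1 ≤ (1 - 2 * a + 3.9 * s) * (1 + 2 * a - 0.14 * s) := by
  have h1 : 0 ≤ s * (a + 1/15000) := mul_nonneg hs.le (by linarith)
  have h2 : 0 ≤ s * (1/1000000 - s) := mul_nonneg hs.le (by linarith)
  ring_nf at *
  linarith

theorem anaB (a s : ℝ) (ha1 : -1/15000 ≤ a) (ha2 : a ≤ 1/15000) (has : a^2 ≤ s/225) (hs : 0 < s)
    (hs1 : s ≤ 1/1000000) : (1 - 2 * a - 3.9 * s) * (1 + 2 * a) ≤ 1 - s := by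
  have h1 : 0 ≤ s * (a + 1/15000) := mul_nonneg hs.le (by linarith)
  have h2 : 0 ≤ a^2 := sq_nonneg a
  ring_nf at *
  linarith

theorem anaC (a s : ℝ) (ha1 : -1/15000 ≤ a) (ha2 : a ≤ 1/15000) (has : a^2 ≤ s/225) (hs : 0 < s)
    (hs1 : s ≤ 1/1000000) : 1 - 2 * a + 3.9 * s ≤ (1 - a + 2 * s) ^ 2 ∧
     (1 - a - 2 * s) ^ 2 ≤ 1 - 2 * a - 3.9 * s := by
  have h1 : 0 ≤ s * (a + 1/15000) := mul_nonneg hs.le (by linarith)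
  have h1' : 0 ≤ s * (1/15000 - a) := mul_nonneg hs.le (by linarith)
  have h2 : 0 ≤ a^2 := sq_nonneg a
  have h2 : 0 ≤ s * (1/1000000 - s) := mul_nonneg hs.le (by linarith)
  have h3 : 0 ≤ s^2 := sq_nonneg s
  constructor
  · ring_nf at *
    linarith
  · ring_nf at *
    linarith

set_option maxHeartbeats 4000000 in
theorem ana2 (u t θ B Y : ℝ) (hu0 : u ≠ 0) (hu : |u| ≤ 1 / 1000) (ht0 : 0 ≤ t) (ht : t ≤ 1 / 15)
    (hθ : |θ| ≤ 6) (hB : 0 < B) (hY1 : 1 ≤ Y) (hY2 : Y ≤ 1 + 3 * u ^ 4)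
    (hBB : B ^ 2 * (1 + 2 * u * t * (1 - u + u * t + θ * u ^ 2)) = (1 - u ^ 2) * Y) :
    |(1 - u + u * t + θ * u ^ 2) ^ 2 * B - 1 + (2 - t) * u| ≤ 20 * u ^ 2 := by
  obtain ⟨hu1, hu2⟩ := abs_le.1 hu
  obtain ⟨hθ1, hθ2⟩ := abs_le.1 hθ
  have hup : 0 < u ^ 2 := by positivity
  have hus : u ^ 2 ≤ 1 / 1000000 := by nlinarith
  set m := -1 + t + θ * u with hm
  have hθu : |θ * u| ≤ 0.006 := by
    rw [abs_mul]
    calc |θ| * |u| ≤ 6 * (1 / 1000) := by gcongr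
      _ = 0.006 := by norm_num
  obtain ⟨hθu1, hθu2⟩ := abs_le.1 hθu
  have hm1 : -1.006 ≤ m := by rw [hm]; linarith
  have hm2 : m ≤ 0 := by rw [hm]; linarith
  have hlam : 1 - u + u * t + θ * u ^ 2 = 1 + u * m := by rw [hm]; ring
  rw [hlam] at hBB ⊢
  have ht2 : t ^ 2 ≤ 1 / 225 := by
    have h : t ^ 2 ≤ (1 / 15) ^ 2 := by gcongr
    linarith
  have htabs : |t| ≤ 1 / 15 := by rw [abs_of_nonneg ht0]; exact ht
  have htm1 : -0.07 ≤ t * m := by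
    have := mulb t m _ 1.006 htabs (abs_le.2 ⟨hm1, by linarith⟩)
    have h2 := neg_abs_le (t * m)
    have h3 : (1 / 15 * 1.006 : ℝ) ≤ 0.07 := by norm_num
    linarith
  have htm2 : t * m ≤ 0 := mul_nonpos_of_nonneg_of_nonpos ht0 hm2
  have hutb := abs_le.1 (mulb u t _ _ hu htabs)
  have hut1 : -1 / 15000 ≤ u * t := by linarith [hutb.1]
  have hut2 : u * t ≤ 1 / 15000 := by linarith [hutb.2]
  have hus2 : -0.07 * u ^ 2 ≤ u ^ 2 * (t * m) := by
    have := mul_le_mul_of_nonneg_left htm1 hup.le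
    linarith
  have hus3 : u ^ 2 * (t * m) ≤ 0 := mul_nonpos_of_nonneg_of_nonpos hup.le htm2
  -- bounds on B
  have hDpos : 0 < 1 + 2 * u * t * (1 + u * m) := by
    have : 1 + 2 * u * t * (1 + u * m) = 1 + 2 * (u * t) + 2 * u ^ 2 * (t * m) := by ring
    rw [this]; linarith
  have h8 : (u * t) ^ 2 ≤ u ^ 2 / 225 := by
    rw [mul_pow]
    have := mul_le_mul_of_nonneg_left ht2 hup.le
    linarith
  have hus2 : -0.07 * u ^ 2 ≤ u ^ 2 * (t * m) := by
    have := mul_le_mul_of_nonneg_left htm1 hup.le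
    linarith
  have hus3 : u ^ 2 * (t * m) ≤ 0 := mul_nonpos_of_nonneg_of_nonpos hup.le htm2
  have hC := anaC _ _ hut1 hut2 h8 hup hus
  have hBu : B ≤ 1 - u * t + 2 * u ^ 2 := by
    by_contra hcon
    push Not at hcon
    have h1 : (1 - u * t + 2 * u ^ 2) ^ 2 * (1 + 2 * u * t * (1 + u * m)) <
        B ^ 2 * (1 + 2 * u * t * (1 + u * m)) := by
      apply mul_lt_mul_of_pos_right _ hDpos
      apply pow_lt_pow_left₀ hcon _ two_ne_zero
      linarith
    have h2 : (1 - u ^ 2) * Y ≤ 1 := by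
      have h3 : u ^ 4 = u ^ 2 * u ^ 2 := by ring
      have h4 : (1 - u ^ 2) * Y ≤ (1 - u ^ 2) * (1 + 3 * u ^ 4) := by
        apply mul_le_mul_of_nonneg_left hY2; linarith
      have h5 : (1 - u ^ 2) * (1 + 3 * u ^ 4) = 1 - u ^ 2 + 3 * (u ^ 2 * u ^ 2) - 3 * u ^ 6 := by ring
      have h6 := mul_le_mul_of_nonneg_left hus hup.le
      have h7 : 0 ≤ u ^ 6 := by positivity
      linarith
    have h5 : 1 ≤ (1 - u * t + 2 * u ^ 2) ^ 2 * (1 + 2 * u * t * (1 + u * m)) := by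
      have h6 : 1 - 2 * (u * t) + 3.9 * u ^ 2 ≤ (1 - u * t + 2 * u ^ 2) ^ 2 := by
        exact hC.1
      have h7 : 1 + 2 * (u * t) - 0.14 * u ^ 2 ≤ 1 + 2 * u * t * (1 + u * m) := by
        have : 1 + 2 * u * t * (1 + u * m) = 1 + 2 * (u * t) + 2 * u ^ 2 * (t * m) := by ring
        rw [this]; linarith
      have h9 : (1 - 2 * (u * t) + 3.9 * u ^ 2) * (1 + 2 * (u * t) - 0.14 * u ^ 2) ≤
          (1 - u * t + 2 * u ^ 2) ^ 2 * (1 + 2 * u * t * (1 + u * m)) := by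
        apply mul_le_mul h6 h7
        · linarith
        · positivity
      have h10 : 1 ≤ (1 - 2 * (u * t) + 3.9 * u ^ 2) * (1 + 2 * (u * t) - 0.14 * u ^ 2) := by
        exact anaA _ _ hut1 hut2 h8 hup hus
      linarith
    linarith
  have hBl : 1 - u * t - 2 * u ^ 2 ≤ B := by
    by_contra hcon
    push Not at hcon
    have h1 : B ^ 2 * (1 + 2 * u * t * (1 + u * m)) < (1 - u * t - 2 * u ^ 2) ^ 2 * (1 + 2 * u * t * (1 + u * m)) := by
      apply mul_lt_mul_of_pos_right _ hDpos
      apply pow_lt_pow_left₀ hcon hB.le two_ne_zero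
    have h2 : 1 - u ^ 2 ≤ (1 - u ^ 2) * Y := le_mul_of_one_le_right (by linarith) hY1
    have h5 : (1 - u * t - 2 * u ^ 2) ^ 2 * (1 + 2 * u * t * (1 + u * m)) ≤ 1 - u ^ 2 := by
      have h6 : (1 - u * t - 2 * u ^ 2) ^ 2 ≤ 1 - 2 * (u * t) - 3.9 * u ^ 2 := by
        exact hC.2
      have h7 : 1 + 2 * u * t * (1 + u * m) ≤ 1 + 2 * (u * t) := by
        have : 1 + 2 * u * t * (1 + u * m) = 1 + 2 * (u * t) + 2 * u ^ 2 * (t * m) := by ring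
        rw [this]; linarith
      have h9 : (1 - u * t - 2 * u ^ 2) ^ 2 * (1 + 2 * u * t * (1 + u * m)) ≤
          (1 - 2 * (u * t) - 3.9 * u ^ 2) * (1 + 2 * (u * t)) := by
        apply mul_le_mul h6 h7 hDpos.le
        linarith
      have h10 : (1 - 2 * (u * t) - 3.9 * u ^ 2) * (1 + 2 * (u * t)) ≤ 1 - u ^ 2 := by
        exact anaB _ _ hut1 hut2 h8 hup hus
      linarith
    linarith
  obtain ⟨β, hβ⟩ : ∃ β, B = 1 - u * t + β * u ^ 2 := ⟨(B - 1 + u * t) / u ^ 2, by field_simp; ring⟩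
  have hβ1 : β ≤ 2 := by
    have h : β * u ^ 2 ≤ 2 * u ^ 2 := by linarith
    exact le_of_mul_le_mul_right h hup
  have hβ2 : -2 ≤ β := by
    have h : -2 * u ^ 2 ≤ β * u ^ 2 := by linarith
    exact le_of_mul_le_mul_right h hup
  have hid : (1 + u * m) ^ 2 * B - 1 + (2 - t) * u =
      u ^ 2 * (2 * θ + m ^ 2 + β + (2 * m + u * m ^ 2) * (-t + β * u)) := by
    rw [hβ, hm]; ring
  rw [hid, abs_mul, abs_of_pos hup, mul_comm]
  apply mul_le_mul_of_nonneg_right _ hup.le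
  have hm3 : m ^ 2 ≤ 1.1 := by
    have := mulb m m 1.006 1.006 (abs_le.2 ⟨hm1, by linarith⟩) (abs_le.2 ⟨hm1, by linarith⟩)
    have h2 := le_abs_self (m * m)
    rw [pow_two]
    norm_num at this ⊢
    linarith
  have hm4 : 0 ≤ m ^ 2 := sq_nonneg m
  have hum : |u * m ^ 2| ≤ 0.1 := by
    have := mulb u (m ^ 2) _ 1.1 hu (by rw [abs_of_nonneg hm4]; exact hm3)
    linarith
  obtain ⟨hum1, hum2⟩ := abs_le.1 hum
  have hβu : |β * u| ≤ 0.1 := by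
    have := mulb β u 2 _ (abs_le.2 ⟨hβ2, hβ1⟩) hu
    linarith
  obtain ⟨hβu1, hβu2⟩ := abs_le.1 hβu
  have hprod : |(2 * m + u * m ^ 2) * (-t + β * u)| ≤ 3 * 0.2 := by
    rw [abs_mul]
    apply mul_le_mul _ _ (abs_nonneg _) (by norm_num)
    · rw [abs_le]; constructor <;> linarith
    · rw [abs_le]; constructor <;> linarith
  obtain ⟨hp1, hp2⟩ := abs_le.1 hprod
  rw [abs_le]; constructor <;> linarith

/-- size of u -/
theorem hard1 (e : ℕ) (he : 15 ≤ e) (σ p c : ℕ) (u Y : ℝ) (hp : 1 ≤ p) (hc : 18 ≤ c)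
    (hu1 : |u| < 1)
    (hpe : 2 * (p : ℝ) ^ e = (σ : ℝ) ^ e * (1 + u))
    (hce : (c : ℝ) ^ e = 4 * ((σ : ℝ) ^ e) ^ 4 * (1 - u ^ 2))
    (hY1 : 1 ≤ Y) (hY2 : Y ≤ 1 + 10 / (c : ℝ) ^ 3)
    (hmain : u ^ 4 * (c : ℝ) ^ 3 = 4 * Y * (1 - u ^ 2)) :
    |u| ≤ 1 / 1000 ∧ (σ : ℝ) ^ 4 ≤ c ∧ Y ≤ 1 + 3 * u ^ 4 ∧ u ≠ 0 ∧ (c : ℝ) ≤ 1.1 * (σ : ℝ) ^ 4 := by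
  have hcR : (18 : ℝ) ≤ c := by exact_mod_cast hc
  have hpR : (1 : ℝ) ≤ p := by exact_mod_cast hp
  have hc3 : (5832 : ℝ) ≤ (c : ℝ) ^ 3 := by
    calc (5832 : ℝ) = 18 ^ 3 := by norm_num
      _ ≤ _ := by gcongr
  have husq : u ^ 2 < 1 := by rw [← sq_abs]; nlinarith [abs_nonneg u]
  have hYb : Y ≤ 1.002 := by
    have : 10 / (c : ℝ) ^ 3 ≤ 10 / 5832 := by gcongr
    norm_num at this ⊢
    linarith
  have hu0 : u ≠ 0 := by
    rintro rfl
    norm_num at hmain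
    linarith
  have hu4 : u ^ 4 * (c : ℝ) ^ 3 ≤ 4.008 := by
    rw [hmain]
    have h2 : 0 < u ^ 2 := by positivity
    nlinarith
  have hu4p : 0 < u ^ 4 := by positivity
  have hu6 : |u| ≤ 1 / 6 := by
    by_contra hcon
    push Not at hcon
    have h1 : (1 / 6 : ℝ) ^ 4 < |u| ^ 4 := by gcongr
    have h2 : |u| ^ 4 = u ^ 4 := by rw [← abs_pow, abs_of_pos hu4p]
    rw [h2] at h1
    have h3 : (1 / 6 : ℝ) ^ 4 * 5832 ≤ u ^ 4 * (c : ℝ) ^ 3 := by gcongr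
    norm_num at h3
    linarith
  obtain ⟨hul, huu⟩ := abs_le.1 hu6
  have husq' : u ^ 2 ≤ 1 / 36 := by rw [← sq_abs]; nlinarith [abs_nonneg u]
  have hσpos : 0 < σ := by
    rcases Nat.eq_zero_or_pos σ with h | h
    · subst h
      have : (0 : ℝ) < 2 * (p : ℝ) ^ e := by positivity
      rw [hpe] at this
      simp [show e ≠ 0 by omega] at this
    · exact h
  have hσR : (0 : ℝ) < σ := by exact_mod_cast hσpos
  have hS : (0 : ℝ) < (σ : ℝ) ^ e := by positivity
  have hσc : (σ : ℝ) ^ 4 ≤ c := by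
    have h1 : ((σ : ℝ) ^ 4) ^ e ≤ (c : ℝ) ^ e := by
      rw [hce, ← pow_mul, mul_comm 4 e, pow_mul]
      have h2 : 0 < ((σ : ℝ) ^ e) ^ 4 := by positivity
      nlinarith
    exact le_of_pow_le_pow_left₀ (by omega) (by positivity) h1
  have hcσ : (c : ℝ) ≤ 1.1 * (σ : ℝ) ^ 4 := by
    have h1 : (c : ℝ) ^ e ≤ (1.1 * (σ : ℝ) ^ 4) ^ e := by
      rw [hce, mul_pow, ← pow_mul (σ : ℝ) 4 e, mul_comm 4 e, pow_mul]
      have h2 : 0 < ((σ : ℝ) ^ e) ^ 4 := by positivity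
      have h3 : (1.1 : ℝ) ^ 15 ≤ 1.1 ^ e := pow_le_pow_right₀ (by norm_num) he
      have h4 : (4 : ℝ) ≤ 1.1 ^ 15 := by norm_num
      have h5 : 4 * ((σ : ℝ) ^ e) ^ 4 ≤ 1.1 ^ e * ((σ : ℝ) ^ e) ^ 4 := by
        apply mul_le_mul_of_nonneg_right _ h2.le
        linarith
      have h6 : 4 * ((σ : ℝ) ^ e) ^ 4 * (1 - u ^ 2) ≤ 4 * ((σ : ℝ) ^ e) ^ 4 := by
        apply mul_le_of_le_one_right (by positivity)
        have : 0 ≤ u ^ 2 := sq_nonneg u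
        linarith
      linarith
    exact le_of_pow_le_pow_left₀ (by omega) (by positivity) h1
  have hpσ : p < σ := by
    have h1 : (p : ℝ) ^ e < (σ : ℝ) ^ e := by nlinarith
    have h2 := lt_of_pow_lt_pow_left₀ e hσR.le h1
    exact_mod_cast h2
  have hp11 : 11 ≤ p := by
    have h1 : ((p : ℝ) + 1) ^ e ≤ (σ : ℝ) ^ e := by
      have : (p : ℝ) + 1 ≤ σ := by exact_mod_cast hpσ
      gcongr
    have h2 : (1 + (1 / (p : ℝ))) ^ e ≤ 2.4 := by
      have h3 : (1 + (1 / (p : ℝ))) ^ e = ((p : ℝ) + 1) ^ e / (p : ℝ) ^ e := by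
        rw [← div_pow]; congr 1; field_simp
      rw [h3, div_le_iff₀ (by positivity)]
      nlinarith
    have h4 := one_add_mul_le_pow (a := 1 / (p : ℝ)) (by
      have : 0 < 1 / (p : ℝ) := by positivity
      linarith) e
    have h5 : (15 : ℝ) * (1 / (p : ℝ)) ≤ e * (1 / (p : ℝ)) := by
      gcongr; exact_mod_cast he
    have h6 : 15 * (1 / (p : ℝ)) ≤ 1.4 := by linarith
    have h7 : (15 : ℝ) ≤ 1.4 * p := by
      rw [mul_one_div, div_le_iff₀ (by positivity)] at h6; exact h6
    have h8 : (10 : ℝ) < p := by linarith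
    exact_mod_cast h8
  have hσ12 : (12 : ℝ) ≤ σ := by exact_mod_cast (by omega : 12 ≤ σ)
  have hu1000 : |u| ≤ 1 / 1000 := by
    by_contra hcon
    push Not at hcon
    have h1 : (1 / 1000 : ℝ) ^ 4 < |u| ^ 4 := by gcongr
    have h2 : |u| ^ 4 = u ^ 4 := by rw [← abs_pow, abs_of_pos hu4p]
    rw [h2] at h1
    have h4 : ((12 : ℝ) ^ 4) ^ 3 ≤ (c : ℝ) ^ 3 := by
      calc ((12 : ℝ) ^ 4) ^ 3 ≤ ((σ : ℝ) ^ 4) ^ 3 := by gcongr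
        _ ≤ _ := by gcongr
    have h3 : (1 / 1000 : ℝ) ^ 4 * ((12 : ℝ) ^ 4) ^ 3 ≤ u ^ 4 * (c : ℝ) ^ 3 := by gcongr
    norm_num at h3
    linarith
  refine ⟨hu1000, hσc, ?_, hu0, hcσ⟩
  have h1 : 10 / (c : ℝ) ^ 3 ≤ 3 * u ^ 4 := by
    rw [div_le_iff₀ (by positivity)]
    have h3 : 4 * 1 * (1 - 1 / 36) ≤ 4 * Y * (1 - u ^ 2) := by
      apply mul_le_mul <;> linarith
    have : 3 * u ^ 4 * (c : ℝ) ^ 3 = 3 * (u ^ 4 * (c : ℝ) ^ 3) := by ring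
    rw [this, hmain]
    norm_num at h3
    linarith
  linarith

/-- size of s -/
theorem hard2 (σ c u Y : ℝ) (hσ : 0 < σ) (hc0 : 0 < c) (hu : |u| ≤ 1 / 1000) (h1 : σ ^ 4 ≤ c)
    (h2 : c ≤ 1.1 * σ ^ 4) (hY1 : 1 ≤ Y) (hY2 : Y ≤ 1 + 3 * u ^ 4)
    (hmain : u ^ 4 * c ^ 3 = 4 * Y * (1 - u ^ 2)) :
    1.316 ≤ σ ^ 3 * |u| ∧ σ ^ 3 * |u| ≤ 1.4151 := by
  have hu2 : u ^ 2 ≤ 1 / 1000000 := by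
    rw [← sq_abs]
    calc |u| ^ 2 ≤ (1 / 1000) ^ 2 := by gcongr
      _ = _ := by norm_num
  have hu2' : 0 ≤ u ^ 2 := sq_nonneg u
  have hu4 : u ^ 4 ≤ 1 / 1000000 := by
    have : u ^ 4 = u ^ 2 * u ^ 2 := by ring
    rw [this]; nlinarith
  have hu4' : 0 ≤ u ^ 4 := by positivity
  have habs : |u| ^ 4 = u ^ 4 := by rw [← abs_pow, abs_of_nonneg hu4']
  have hs : (σ ^ 3 * |u|) ^ 4 = u ^ 4 * (σ ^ 4) ^ 3 := by rw [mul_pow, habs]; ring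
  have hcu : u ^ 4 * (σ ^ 4) ^ 3 ≤ u ^ 4 * c ^ 3 := by gcongr
  have hcl : u ^ 4 * c ^ 3 ≤ u ^ 4 * (1.1 * σ ^ 4) ^ 3 := by gcongr
  have hR1 : 4 * Y * (1 - u ^ 2) ≤ 4.00002 := by nlinarith
  have hR2 : 3.9999 ≤ 4 * Y * (1 - u ^ 2) := by nlinarith
  constructor
  · apply le_of_pow_le_pow_left₀ (n := 4) (by norm_num) (by positivity)
    rw [hs]
    have h3 : u ^ 4 * (1.1 * σ ^ 4) ^ 3 = 1.331 * (u ^ 4 * (σ ^ 4) ^ 3) := by ring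
    norm_num at *
    linarith
  · apply le_of_pow_le_pow_left₀ (n := 4) (by norm_num) (by positivity)
    rw [hs]
    norm_num at *
    linarith

theorem mod9 (e Q r σ Z : ℤ) (h3 : 3 ∣ e) (hZ : Z = e ^ 2 * r ^ 2 * Q - 8 * σ ^ 3)
    (h1 : 19 < |Z|) (h2 : |Z| < 26) : False := by
  obtain ⟨m, rfl⟩ := h3
  have h4 : Z % 9 = (σ ^ 3) % 9 := by
    have : Z = σ ^ 3 + 9 * (m ^ 2 * r ^ 2 * Q - σ ^ 3) := by rw [hZ]; ring
    rw [this]; simp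
  have h5 : σ ^ 3 % 9 = 0 ∨ σ ^ 3 % 9 = 1 ∨ σ ^ 3 % 9 = 8 := by
    have h6 : σ % 9 = 0 ∨ σ % 9 = 1 ∨ σ % 9 = 2 ∨ σ % 9 = 3 ∨ σ % 9 = 4 ∨ σ % 9 = 5 ∨ σ % 9 = 6 ∨ σ % 9 = 7 ∨ σ % 9 = 8 := by omega
    rcases h6 with h | h | h | h | h | h | h | h | h <;> simp [pow_succ, Int.mul_emod, h]
  rw [← h4] at h5
  rcases abs_cases Z with h | h <;> omega

set_option maxHeartbeats 1000000 in
theorem hard (e : ℕ) (he : 15 ≤ e) (he3 : 3 ∣ e) (σ p Q c : ℕ) (z : ℤ) (w : ℕ) (Y : ℝ)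
    (hσ3 : 3 ≤ σ) (hp : 1 ≤ p) (hQ : 1 ≤ Q) (hQe : Even Q) (hc : c = σ ^ 2 * (p * Q))
    (hz : z ^ 2 = (w : ℤ) ^ 2) (hzS : |z| < (σ : ℤ) ^ e) (h1 : 2 * (p : ℤ) ^ e = σ ^ e + z)
    (h2 : (Q : ℤ) ^ e = 8 * (σ ^ e - z)) (hY1 : 1 ≤ Y) (hY2 : Y ≤ 1 + 10 / (c : ℝ) ^ 3)
    (hw : (w : ℝ) ^ 4 * (c : ℝ) ^ 3 = Y * (c : ℝ) ^ e) : False := by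
  have hc18 : 18 ≤ c := by
    obtain ⟨m, hm⟩ := hQe
    have : 1 * 2 ≤ p * Q := Nat.mul_le_mul hp (by omega)
    rw [hc]; nlinarith
  have hσR : (0 : ℝ) < σ := by exact_mod_cast (by omega : 0 < σ)
  have hpR : (0 : ℝ) < p := by exact_mod_cast (by omega : 0 < p)
  have hQR : (0 : ℝ) < Q := by exact_mod_cast (by omega : 0 < Q)
  have hcR : (0 : ℝ) < c := by exact_mod_cast (by omega : 0 < c)
  have heR : (15 : ℝ) ≤ e := by exact_mod_cast he
  have he0 : (0 : ℝ) < e := by linarith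
  have hcc : (c : ℝ) = σ ^ 2 * (p * Q) := by rw [hc]; push_cast; ring
  obtain ⟨S, hS⟩ : ∃ S : ℝ, S = (σ : ℝ) ^ e := ⟨_, rfl⟩
  have hS0 : 0 < S := by rw [hS]; positivity
  obtain ⟨u, hu⟩ : ∃ u : ℝ, u = z / S := ⟨_, rfl⟩
  have hzu : (z : ℝ) = S * u := by rw [hu]; field_simp
  have hpe : 2 * (p : ℝ) ^ e = S * (1 + u) := by
    have : 2 * (p : ℝ) ^ e = (σ : ℝ) ^ e + z := by exact_mod_cast h1
    rw [this, ← hS, hzu]; ring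
  have hQe' : (Q : ℝ) ^ e = 8 * S * (1 - u) := by
    have : (Q : ℝ) ^ e = 8 * ((σ : ℝ) ^ e - z) := by exact_mod_cast h2
    rw [this, ← hS, hzu]; ring
  have hu1 : |u| < 1 := by
    rw [hu, abs_div, abs_of_pos hS0, div_lt_one hS0, hS]
    exact_mod_cast hzS
  have hce : (c : ℝ) ^ e = 4 * S ^ 4 * (1 - u ^ 2) := by
    have hp' : (p : ℝ) ^ e = S * (1 + u) / 2 := by linarith
    rw [hcc, mul_pow, mul_pow, hQe', hp', ← pow_mul, mul_comm 2 e, pow_mul, ← hS]; ring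
  have hw4 : (w : ℝ) ^ 4 = S ^ 4 * u ^ 4 := by
    have : (z : ℝ) ^ 2 = (w : ℝ) ^ 2 := by exact_mod_cast hz
    calc (w : ℝ) ^ 4 = ((w : ℝ) ^ 2) ^ 2 := by ring
      _ = S ^ 4 * u ^ 4 := by rw [← this, hzu]; ring
  have hmain : u ^ 4 * (c : ℝ) ^ 3 = 4 * Y * (1 - u ^ 2) := by
    rw [hw4, hce] at hw
    have h4 : 0 < S ^ 4 := by positivity
    apply mul_left_cancel₀ h4.ne'
    linarith
  obtain ⟨hu1000, hσc, hY3, hu0, hcσ⟩ := hard1 e he σ p c u Y hp hc18 hu1 (by rw [← hS]; exact hpe)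
    (by rw [← hS]; exact hce) hY1 hY2 hmain
  obtain ⟨hs1, hs2⟩ := hard2 σ c u Y hσR hcR hu1000 hσc hcσ hY1 hY3 hmain
  obtain ⟨r, hr⟩ : ∃ r : ℤ, r = (Q : ℤ) * p ^ 3 - σ ^ 4 := ⟨_, rfl⟩
  have hrR : (r : ℝ) = Q * p ^ 3 - σ ^ 4 := by rw [hr]; push_cast; ring
  obtain ⟨ρ, hρ⟩ : ∃ ρ : ℝ, ρ = r / σ ^ 4 := ⟨_, rfl⟩
  have hρ1 : 1 + ρ = Q * p ^ 3 / σ ^ 4 := by rw [hρ, hrR]; field_simp; ring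
  have hρpos : 0 < 1 + ρ := by rw [hρ1]; positivity
  have hρe : (1 + ρ) ^ e = 1 + 2 * u - 2 * u ^ 3 - u ^ 4 := by
    have hp' : (p : ℝ) ^ e = S * (1 + u) / 2 := by linarith
    rw [hρ1, div_pow, mul_pow, ← pow_mul, ← pow_mul, mul_comm 3 e, mul_comm 4 e, pow_mul, pow_mul, ← hS,
      hQe', hp']
    field_simp; ring
  have hA := ana1 e he u ρ hu1000 hρpos hρe
  obtain ⟨t, ht⟩ : ∃ t : ℝ, t = 1 / e := ⟨_, rfl⟩
  have ht0 : 0 ≤ t := by rw [ht]; positivity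
  have ht15 : t ≤ 1 / 15 := by rw [ht]; gcongr
  have het : (e : ℝ) * t = 1 := by rw [ht]; field_simp
  obtain ⟨θ, hθ⟩ : ∃ θ : ℝ, θ = (e * ρ - (2 * u - 2 * u ^ 2 + 2 * u ^ 2 / e)) / (2 * u ^ 3) := ⟨_, rfl⟩
  have hθ6 : |θ| ≤ 6 := by
    have h3 : 0 < |u| := abs_pos.2 hu0
    rw [hθ, abs_div, div_le_iff₀ (by positivity), abs_mul, abs_two, abs_pow]
    have : 0 < |u| ^ 3 := by positivity
    linarith
  have hlam : 2 * u * (1 - u + u * t + θ * u ^ 2) = e * ρ := by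
    have h3 : 2 * u ^ 3 * θ = e * ρ - (2 * u - 2 * u ^ 2 + 2 * u ^ 2 * t) := by
      rw [hθ, ht]; field_simp
    linear_combination h3
  obtain ⟨lam, hl⟩ : ∃ lam : ℝ, lam = 1 - u + u * t + θ * u ^ 2 := ⟨_, rfl⟩
  obtain ⟨B, hB⟩ : ∃ B : ℝ, B = u ^ 2 * σ ^ 5 * Q / 2 := ⟨_, rfl⟩
  have hu2 : 0 < u ^ 2 := by positivity
  have hB0 : 0 < B := by rw [hB]; positivity
  have hBB : B ^ 2 * (1 + 2 * u * t * (1 - u + u * t + θ * u ^ 2)) = (1 - u ^ 2) * Y := by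
    have h3 : 1 + 2 * u * t * (1 - u + u * t + θ * u ^ 2) = 1 + ρ := by
      linear_combination t * hlam + ρ * het
    rw [h3, hρ1, hB]
    have h4 : (u ^ 2 * σ ^ 5 * Q / 2 : ℝ) ^ 2 * (Q * p ^ 3 / σ ^ 4) = u ^ 4 * (c : ℝ) ^ 3 / 4 := by
      rw [hcc]; field_simp; ring
    rw [h4, hmain]; ring
  have hA2 := ana2 u t θ B Y hu0 hu1000 ht0 ht15 hθ6 hB0 hY1 hY3 hBB
  rw [← hl] at hA2 hlam
  obtain ⟨Z, hZ⟩ : ∃ Z : ℤ, Z = (e : ℤ) ^ 2 * r ^ 2 * Q - 8 * σ ^ 3 := ⟨_, rfl⟩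
  have hZR : (Z : ℝ) = 8 * σ ^ 3 * (lam ^ 2 * B - 1) := by
    have h3 : (Z : ℝ) = (e : ℝ) ^ 2 * r ^ 2 * Q - 8 * σ ^ 3 := by rw [hZ]; push_cast; ring
    have h4 : (r : ℝ) = ρ * σ ^ 4 := by rw [hρ]; field_simp
    have h5 : (4 * u ^ 2) * lam ^ 2 = (e * ρ) ^ 2 := by rw [← hlam]; ring
    rw [h3, h4, hB]
    linear_combination (-(σ : ℝ) ^ 8 * Q) * h5
  have hua : 0 ≤ |u| := abs_nonneg u
  have hu2a : u ^ 2 = |u| * |u| := by rw [← sq_abs]; ring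
  have h2t : |(2 - t) * u| = (2 - t) * |u| := by
    rw [abs_mul, abs_of_pos (by linarith)]
  have hZabs : (|Z| : ℤ) = 8 * (σ : ℝ) ^ 3 * |lam ^ 2 * B - 1| := by
    rw [Int.cast_abs, hZR, abs_mul, abs_of_pos (by positivity : (0 : ℝ) < 8 * σ ^ 3)]
  have hua2 : 20 * u ^ 2 ≤ 0.02 * |u| := by
    have := mul_le_mul_of_nonneg_left hu1000 hua
    rw [hu2a]; linarith
  have htu1 : 0 ≤ t * |u| := mul_nonneg ht0 hua
  have htu2 : t * |u| ≤ 1 / 15 * |u| := mul_le_mul_of_nonneg_right ht15 hua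
  have hub : |lam ^ 2 * B - 1| ≤ |u| * 2.02 := by
    have h3 := abs_sub (lam ^ 2 * B - 1 + (2 - t) * u) ((2 - t) * u)
    rw [add_sub_cancel_right, h2t] at h3
    linarith
  have hlb : |u| * 1.91 ≤ |lam ^ 2 * B - 1| := by
    have h3 := abs_sub (lam ^ 2 * B - 1 + (2 - t) * u) (lam ^ 2 * B - 1)
    rw [add_sub_cancel_left, h2t] at h3
    linarith
  have hσ3 : (0 : ℝ) < 8 * σ ^ 3 := by positivity
  have hub2 := mul_le_mul_of_nonneg_left hub hσ3.le
  have hlb2 := mul_le_mul_of_nonneg_left hlb hσ3.le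
  rw [← hZabs] at hub2 hlb2
  have hf1 : ((19 : ℤ) : ℝ) < (|Z| : ℤ) := by push_cast at *; linarith
  have hf2 : ((|Z| : ℤ) : ℝ) < (26 : ℤ) := by push_cast at *; linarith
  exact mod9 e Q r σ Z (by exact_mod_cast he3) hZ (by exact_mod_cast hf1) (by exact_mod_cast hf2)

theorem small_case (σ Q : ℕ) (z : ℤ) (hσ3 : 3 ≤ σ) (hz : z ^ 2 = 1)
    (h2 : (Q : ℤ) ^ 3 = 8 * (σ ^ 3 - z)) : False := by
  have hσ : (3 : ℤ) ≤ σ := by exact_mod_cast hσ3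
  have hz1 : z ≠ 0 := by rintro rfl; norm_num at hz
  have hz2 : z ≤ 1 := by nlinarith
  have hz3 : -1 ≤ z := by nlinarith
  have hQ0 : (0 : ℤ) ≤ Q := by positivity
  rcases lt_trichotomy (Q : ℤ) (2 * σ) with h | h | h
  · have h3 : (Q : ℤ) ^ 3 ≤ (2 * σ - 1) ^ 3 := by
      apply pow_le_pow_left₀ hQ0; omega
    nlinarith
  · rw [h] at h2
    apply hz1; linarith
  · have h3 : (2 * (σ : ℤ) + 1) ^ 3 ≤ (Q : ℤ) ^ 3 := by
      apply pow_le_pow_left₀ (by positivity); omega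
    nlinarith

theorem mid_case (e : ℕ) (he : 3 ≤ e) (σ p Q c : ℕ) (z : ℤ) (w : ℕ)
    (hσo : Odd σ) (hσ3 : 3 ≤ σ) (hp : 1 ≤ p) (hQ : 1 ≤ Q) (hQe : Even Q) (hc : c = σ ^ 2 * (p * Q))
    (hz : z ^ 2 = (w : ℤ) ^ 2) (hzS : |z| < (σ : ℤ) ^ e) (h1 : 2 * (p : ℤ) ^ e = σ ^ e + z)
    (h2 : (Q : ℤ) ^ e = 8 * (σ ^ e - z))
    (hw : w ^ 4 * c ^ 7 ≤ 2 * c ^ e) : False := by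
  have hc18 : 18 ≤ c := by
    obtain ⟨m, hm⟩ := hQe
    have : 1 * 2 ≤ p * Q := Nat.mul_le_mul hp (by omega)
    rw [hc]; nlinarith
  have hσR : (3 : ℝ) ≤ σ := by exact_mod_cast hσ3
  have hσ0 : (0 : ℝ) < σ := by linarith
  have hpR : (0 : ℝ) < p := by exact_mod_cast (by omega : 0 < p)
  have hQR : (0 : ℝ) < Q := by exact_mod_cast (by omega : 0 < Q)
  have hcR : (18 : ℝ) ≤ c := by exact_mod_cast hc18
  have hcc : (c : ℝ) = σ ^ 2 * (p * Q) := by rw [hc]; push_cast; ring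
  obtain ⟨S, hS⟩ : ∃ S : ℝ, S = (σ : ℝ) ^ e := ⟨_, rfl⟩
  have hS0 : 0 < S := by rw [hS]; positivity
  obtain ⟨u, hu⟩ : ∃ u : ℝ, u = z / S := ⟨_, rfl⟩
  have hzu : (z : ℝ) = S * u := by rw [hu]; field_simp
  have hpe : 2 * (p : ℝ) ^ e = S * (1 + u) := by
    have : 2 * (p : ℝ) ^ e = (σ : ℝ) ^ e + z := by exact_mod_cast h1
    rw [this, ← hS, hzu]; ring
  have hp' : (p : ℝ) ^ e = S * (1 + u) / 2 := by linarith
  have hQe' : (Q : ℝ) ^ e = 8 * S * (1 - u) := by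
    have : (Q : ℝ) ^ e = 8 * ((σ : ℝ) ^ e - z) := by exact_mod_cast h2
    rw [this, ← hS, hzu]; ring
  have hce : (c : ℝ) ^ e = 4 * S ^ 4 * (1 - u ^ 2) := by
    rw [hcc, mul_pow, mul_pow, hQe', hp', ← pow_mul, mul_comm 2 e, pow_mul, ← hS]; ring
  have hw4 : (w : ℝ) ^ 4 = S ^ 4 * u ^ 4 := by
    have : (z : ℝ) ^ 2 = (w : ℝ) ^ 2 := by exact_mod_cast hz
    calc (w : ℝ) ^ 4 = ((w : ℝ) ^ 2) ^ 2 := by ring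
      _ = S ^ 4 * u ^ 4 := by rw [← this, hzu]; ring
  have hu20 : 0 ≤ u ^ 2 := sq_nonneg u
  have hu40 : 0 ≤ u ^ 4 := by positivity
  have hS4 : 0 < S ^ 4 := by positivity
  have hmain : u ^ 4 * (c : ℝ) ^ 7 ≤ 8 := by
    have hwR : (w : ℝ) ^ 4 * (c : ℝ) ^ 7 ≤ 2 * (c : ℝ) ^ e := by exact_mod_cast hw
    rw [hw4, hce] at hwR
    have h3 : u ^ 4 * (c : ℝ) ^ 7 ≤ 8 * (1 - u ^ 2) := by
      apply le_of_mul_le_mul_left _ hS4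
      linarith
    linarith
  have habs : |u| ^ 4 = u ^ 4 := by rw [← abs_pow, abs_of_nonneg hu40]
  have hu2 : |u| ≤ 1 / 4 := by
    by_contra hcon
    push Not at hcon
    have h3 : (1 / 4 : ℝ) ^ 4 < |u| ^ 4 := by gcongr
    rw [habs] at h3
    have h4 : (1 / 4 : ℝ) ^ 4 * 18 ^ 7 ≤ u ^ 4 * (c : ℝ) ^ 7 := by gcongr
    norm_num at h4
    linarith
  have hu2' : u ^ 2 ≤ 1 / 16 := by
    rw [← sq_abs]
    calc |u| ^ 2 ≤ (1 / 4) ^ 2 := by gcongr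
      _ = _ := by norm_num
  have hσc : (σ : ℝ) ^ 4 ≤ c := by
    have h1 : ((σ : ℝ) ^ 4) ^ e ≤ (c : ℝ) ^ e := by
      rw [hce, ← pow_mul, mul_comm 4 e, pow_mul, ← hS]
      nlinarith
    exact le_of_pow_le_pow_left₀ (by omega) (by positivity) h1
  have hus : |u| * (σ : ℝ) ^ 7 ≤ 2 := by
    apply le_of_pow_le_pow_left₀ (n := 4) (by norm_num) (by norm_num)
    rw [mul_pow, habs]
    have h3 : u ^ 4 * ((σ : ℝ) ^ 4) ^ 7 ≤ u ^ 4 * (c : ℝ) ^ 7 := by gcongr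
    have h4 : ((σ : ℝ) ^ 7) ^ 4 = ((σ : ℝ) ^ 4) ^ 7 := by ring
    rw [h4]; norm_num; linarith
  obtain ⟨M, hM⟩ : ∃ M : ℝ, M = (σ : ℝ) ^ 4 := ⟨_, rfl⟩
  have hM0 : 0 < M := by rw [hM]; positivity
  have huM : 3 * |u| < 1 / M := by
    rw [lt_div_iff₀ hM0]
    have h3 : (σ : ℝ) ^ 7 = σ ^ 3 * M := by rw [hM]; ring
    rw [h3] at hus
    have h4 : (3 : ℝ) ^ 3 ≤ (σ : ℝ) ^ 3 := by gcongr
    have h5 : |u| * (3 ^ 3 * M) ≤ |u| * (σ ^ 3 * M) := by gcongr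
    norm_num at h5
    linarith
  obtain ⟨q, hq⟩ : ∃ q : ℝ, q = 1 + 2 * u - 2 * u ^ 3 - u ^ 4 := ⟨_, rfl⟩
  have hqb : |q - 1| ≤ 3 * |u| := by
    have h3 : q - 1 = u * (2 - 2 * u ^ 2 - u ^ 2 * u) := by rw [hq]; ring
    rw [h3, abs_mul, mul_comm 3]
    apply mul_le_mul_of_nonneg_left _ (abs_nonneg u)
    obtain ⟨h5, h6⟩ := abs_le.1 hu2
    rw [abs_le]; constructor <;> nlinarith
  obtain ⟨hq1, hq2⟩ := abs_le.1 hqb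
  have hNq : ((Q : ℝ) * p ^ 3 / M) ^ e = q := by
    rw [hM, hq, div_pow, mul_pow, ← pow_mul, ← pow_mul, mul_comm 3 e, mul_comm 4 e, pow_mul, pow_mul, ← hS,
      hQe', hp']
    field_simp; ring
  have hne : Q * p ^ 3 ≠ σ ^ 4 := by
    intro h
    have h3 : Odd (σ ^ 4) := hσo.pow
    rw [← h] at h3
    exact (Nat.not_odd_iff_even.2 (hQe.mul_right _)) h3
  rcases lt_or_gt_of_ne hne with h | h
  · have h3 : (Q : ℝ) * p ^ 3 + 1 ≤ M := by rw [hM]; exact_mod_cast h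
    have h4 : (Q : ℝ) * p ^ 3 / M ≤ 1 - 1 / M := by
      rw [div_le_iff₀ hM0]; field_simp; linarith
    have h0 : 0 ≤ (Q : ℝ) * p ^ 3 / M := by positivity
    have h5 : ((Q : ℝ) * p ^ 3 / M) ^ e ≤ (Q : ℝ) * p ^ 3 / M := by
      apply pow_le_of_le_one h0 _ (by omega)
      have : 0 < 1 / M := by positivity
      linarith
    linarith
  · have h3 : M + 1 ≤ (Q : ℝ) * p ^ 3 := by rw [hM]; exact_mod_cast h
    have h4 : 1 + 1 / M ≤ (Q : ℝ) * p ^ 3 / M := by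
      rw [le_div_iff₀ hM0]; field_simp; linarith
    have h5 : (Q : ℝ) * p ^ 3 / M ≤ ((Q : ℝ) * p ^ 3 / M) ^ e := by
      apply le_self_pow₀ _ (by omega)
      have : 0 < 1 / M := by positivity
      linarith
    linarith

/-- numerators -/
def seqA (d : ℕ) (c : ℤ) : ℕ → ℤ
  | 0 => 1
  | k + 1 => seqA d c k ^ d + c ^ (d ^ (k + 1) - 1)

/-- normalised values -/
noncomputable def seqY (d : ℕ) (c : ℤ) : ℕ → ℝ
  | 0 => 1
  | k + 1 => 1 + seqY d c k ^ d / (c : ℝ) ^ (d - 1)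

theorem seqA_coprime (d : ℕ) (hd : 4 ≤ d) (c : ℤ) (k : ℕ) : IsCoprime (seqA d c k) c := by
  induction k with
  | zero => exact isCoprime_one_left
  | succ k ih =>
    have h1 : d ^ (k + 1) - 1 ≠ 0 := by
      have : 4 ≤ d ^ (k + 1) := hd.trans (Nat.le_self_pow (by omega) d)
      omega
    obtain ⟨m, hm⟩ := Nat.exists_eq_succ_of_ne_zero h1
    simp only [seqA]
    rw [hm, pow_succ]
    exact (ih.pow_left).add_mul_right_left _

theorem exp_split (d k : ℕ) (hd : 4 ≤ d) :
    d * (d ^ k - 1) + (d - 1) = d ^ (k + 1) - 1 := by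
  have h1 : 1 ≤ d ^ k := Nat.one_le_pow _ _ (by omega)
  obtain ⟨m, hm⟩ := Nat.exists_eq_add_of_le h1
  rw [pow_succ, hm, Nat.add_sub_cancel_left, add_mul, one_mul, mul_comm m d]
  omega

theorem seqA_Y (d : ℕ) (hd : 4 ≤ d) (c : ℤ) (hc : c ≠ 0) (k : ℕ) :
    (seqA d c k : ℝ) = seqY d c k * (c : ℝ) ^ (d ^ k - 1) := by
  have hcR : (c : ℝ) ≠ 0 := by exact_mod_cast hc
  induction k with
  | zero => simp [seqA, seqY]
  | succ k ih =>
    simp only [seqA, seqY]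
    push_cast
    rw [ih, mul_pow, ← pow_mul, mul_comm (d ^ k - 1) d, ← exp_split d k hd, pow_add]
    field_simp
    ring

theorem seqA_pow (d : ℕ) (hd : 4 ≤ d) (c : ℤ) (hc : c ≠ 0) (k : ℕ) :
    (seqA d c k : ℝ) ^ d * (c : ℝ) ^ (d - 1) = seqY d c k ^ d * (c : ℝ) ^ (d ^ (k + 1) - 1) := by
  rw [seqA_Y d hd c hc, mul_pow, ← pow_mul, mul_comm (d ^ k - 1) d, ← exp_split d k hd, pow_add]
  ring

theorem seqY_neg (d : ℕ) (hd : 4 ≤ d) (hde : Even d) (c : ℤ) (hc : c ≤ -2) (k : ℕ) :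
    0 < seqY d c k ∧ seqY d c k ≤ 1 := by
  induction k with
  | zero => simp [seqY]
  | succ k ih =>
    have hodd : Odd (d - 1) := Nat.Even.sub_odd (by omega) hde odd_one
    have hcR : (2 : ℝ) ≤ -(c : ℝ) := by
      have : (c : ℝ) ≤ -2 := by exact_mod_cast hc
      linarith
    have h1 : (c : ℝ) ^ (d - 1) = -(-(c : ℝ)) ^ (d - 1) := by rw [hodd.neg_pow]; ring
    have h2 : (2 : ℝ) ≤ (-(c : ℝ)) ^ (d - 1) :=
      hcR.trans (le_self_pow₀ (by linarith) (by omega))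
    have h3 : seqY d c k ^ d ≤ 1 := pow_le_one₀ ih.1.le ih.2
    have h4 : 0 < seqY d c k ^ d := pow_pos ih.1 _
    simp only [seqY]
    rw [h1, div_neg]
    have h5 : seqY d c k ^ d / (-(c : ℝ)) ^ (d - 1) ≤ 1 / 2 := by gcongr
    have h6 : 0 < seqY d c k ^ d / (-(c : ℝ)) ^ (d - 1) := by positivity
    constructor <;> linarith

theorem four_pow_bound (d : ℕ) (hd : 4 ≤ d) : 4 * d ≤ 4 ^ (d - 1) := by
  obtain ⟨m, rfl⟩ := Nat.exists_eq_add_of_le hd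
  have : 4 + m - 1 = m + 3 := by omega
  rw [this]
  clear this hd
  induction m with
  | zero => norm_num
  | succ m ih => rw [show m + 1 + 3 = (m + 3) + 1 by ring, pow_succ]; omega

theorem y_pow_le_two (d : ℕ) (hd : 4 ≤ d) (c y : ℝ) (hc : 4 ≤ c) (hy0 : 0 ≤ y)
    (hy : y ≤ 1 + 2 / c ^ (d - 1)) : y ^ d ≤ 2 := by
  set a := 2 / c ^ (d - 1) with ha
  have ha0 : 0 ≤ a := by positivity
  have hd0 : (0 : ℝ) < d := by exact_mod_cast (by omega : 0 < d)
  have had : d * a ≤ 1 / 2 := by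
    have h1 : (4 : ℝ) * d ≤ 4 ^ (d - 1) := by exact_mod_cast four_pow_bound d hd
    have h2 : (4 : ℝ) ^ (d - 1) ≤ c ^ (d - 1) := by gcongr
    have h3 : a ≤ 2 / (4 * d) := by
      rw [ha]; gcongr; linarith
    calc d * a ≤ d * (2 / (4 * d)) := by gcongr
      _ = 1 / 2 := by field_simp; norm_num
  have ha1 : a ≤ 1 := by
    have : (4 : ℝ) ≤ d := by exact_mod_cast hd
    nlinarith
  have h1 := one_add_mul_le_pow (a := -a) (by linarith) d
  have h2 : y ^ d ≤ (1 + a) ^ d := by gcongr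
  have h3 : (1 + a) ^ d * (1 + -a) ^ d ≤ 1 := by
    rw [← mul_pow]
    apply pow_le_one₀ <;> nlinarith
  have h4 : 0 ≤ (1 + a) ^ d := by positivity
  nlinarith

theorem seqY_pos (d : ℕ) (hd : 4 ≤ d) (c : ℤ) (hc : 4 ≤ c) (k : ℕ) :
    1 ≤ seqY d c k ∧ seqY d c k ≤ 1 + 2 / (c : ℝ) ^ (d - 1) := by
  have hcR : (4 : ℝ) ≤ c := by exact_mod_cast hc
  induction k with
  | zero =>
    simp only [seqY, le_refl, true_and]
    have : 0 < 2 / (c : ℝ) ^ (d - 1) := by positivity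
    linarith
  | succ k ih =>
    have h1 := y_pow_le_two d hd c _ hcR (by linarith [ih.1]) ih.2
    have h2 : 0 ≤ seqY d c k := by linarith [ih.1]
    simp only [seqY]
    constructor
    · have : 0 ≤ seqY d c k ^ d / (c : ℝ) ^ (d - 1) := by positivity
      linarith
    · gcongr

theorem Y_bound (c y : ℝ) (hc : 18 ≤ c) (h1 : 1 ≤ y) (h2 : y ≤ 1 + 2 / c ^ 3) :
    y ^ 4 ≤ 1 + 10 / c ^ 3 := by
  obtain ⟨x, hx⟩ : ∃ x : ℝ, x = 1 / c ^ 3 := ⟨_, rfl⟩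
  have hx0 : 0 < x := by rw [hx]; positivity
  have hx1 : x ≤ 1 / 100 := by
    rw [hx]
    have : (100 : ℝ) ≤ c ^ 3 := by
      calc (100 : ℝ) ≤ 18 ^ 3 := by norm_num
        _ ≤ _ := by gcongr
    gcongr
  have e1 : 2 / c ^ 3 = 2 * x := by rw [hx]; ring
  have e2 : 10 / c ^ 3 = 10 * x := by rw [hx]; ring
  rw [e1] at h2
  rw [e2]
  calc y ^ 4 ≤ (1 + 2 * x) ^ 4 := by gcongr
    _ = 1 + 8 * x + 24 * x * x + 32 * x * (x * x) + 16 * x * (x * (x * x)) := by ring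
    _ ≤ 1 + 10 * x := by
      have h3 : x * x ≤ 1 / 100 * x := by gcongr
      have h4 : x * (x * x) ≤ 1 / 100 * (1 / 100 * x) := by gcongr
      have h5 : x * (x * (x * x)) ≤ 1 / 100 * (1 / 100 * (1 / 100 * x)) := by gcongr
      linarith

set_option maxHeartbeats 2000000 in
theorem final_int (r k : ℕ) (hr : 2 ≤ r) (d : ℕ) (hd : d = 2 ^ r) (c : ℤ) (hc : c ≠ 0) (U : ℤ)
    (heq : 4 * U ^ 2 * (U ^ 2 - seqA d c k ^ (d / 2)) = c ^ (d ^ (k + 1) - 1)) : False := by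
  obtain ⟨q, hq⟩ : ∃ q, r = q + 2 := ⟨r - 2, by omega⟩
  have hd4q : d = 4 * 2 ^ q := by rw [hd, hq, pow_add]; ring
  have hq1 : 1 ≤ 2 ^ q := Nat.one_le_two_pow
  have hd4 : 4 ≤ d := by omega
  have hde : Even d := ⟨2 * 2 ^ q, by omega⟩
  have hd2 : d / 2 = 2 * 2 ^ q := by omega
  obtain ⟨e, he⟩ : ∃ e, e = d ^ (k + 1) - 1 := ⟨_, rfl⟩
  have hD : d ≤ d ^ (k + 1) := Nat.le_self_pow (by omega) d
  have heo : Odd e := by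
    rw [he]; exact Nat.Even.sub_odd (by omega) (hde.pow_of_ne_zero (by omega)) odd_one
  have he3 : 3 ≤ e := by omega
  obtain ⟨A, hA⟩ : ∃ A, A = seqA d c k := ⟨_, rfl⟩
  have hcop : IsCoprime A c := hA ▸ seqA_coprime d hd4 c k
  obtain ⟨w, hw⟩ : ∃ w : ℕ, w = A.natAbs ^ (2 ^ q) := ⟨_, rfl⟩
  obtain ⟨n, hn⟩ : ∃ n : ℕ, n = c.natAbs := ⟨_, rfl⟩
  have hwA : (w : ℤ) ^ 2 = A ^ (d / 2) := by
    rw [hd2, hw]; push_cast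
    rw [← pow_mul, mul_comm, pow_mul, sq_abs, ← pow_mul]
  have hwA4 : (w : ℤ) ^ 4 = A ^ d := by
    have : (w : ℤ) ^ 4 = ((w : ℤ) ^ 2) ^ 2 := by ring
    rw [this, hwA, ← pow_mul]; congr 1; omega
  have hcopn : Nat.Coprime w n := by
    rw [hw, hn]
    have h0 : Nat.Coprime A.natAbs c.natAbs := Int.isCoprime_iff_gcd_eq_one.1 hcop
    exact Nat.Coprime.pow_left _ h0
  rw [← hA, ← he, ← hwA] at heq
  have hpow := seqA_pow d hd4 c hc k
  rw [← hA, ← he] at hpow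
  have hwA4R : (A : ℝ) ^ d = (w : ℝ) ^ 4 := by exact_mod_cast hwA4.symm
  rw [hwA4R] at hpow
  have hc2 : (2 : ℤ) ∣ c := by
    apply Int.prime_two.dvd_of_dvd_pow (n := e)
    rw [← heq]
    exact ⟨2 * U ^ 2 * (U ^ 2 - w ^ 2), by ring⟩
  have hn2 : 2 ≤ n := by omega
  have hw1 : 1 ≤ w := by
    rcases Nat.eq_zero_or_pos w with h | h
    · rw [h, Nat.coprime_zero_left] at hcopn; omega
    · exact h
  rcases lt_or_gt_of_ne hc with hneg | hpos
  · -- c negative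
    have hcn : c = -(n : ℤ) := by omega
    have hy := seqY_neg d hd4 hde c (by omega) k
    have hyd : seqY d c k ^ d ≤ 1 := pow_le_one₀ hy.1.le hy.2
    have hodd : Odd (d - 1) := Nat.Even.sub_odd (by omega) hde odd_one
    have hcnR : (c : ℝ) = -(n : ℝ) := by rw [hcn]; push_cast; ring
    rw [hcnR, hodd.neg_pow, heo.neg_pow] at hpow
    rw [hcn, heo.neg_pow] at heq
    have hnR : (2 : ℝ) ≤ n := by exact_mod_cast hn2
    have h1 : (w : ℝ) ^ 4 * (n : ℝ) ^ (d - 1) ≤ (n : ℝ) ^ e := by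
      have h0 : 0 < (n : ℝ) ^ e := by positivity
      have := mul_le_mul_of_nonneg_right hyd h0.le
      linarith
    have h2 : w ^ 4 * n ^ (d - 1) ≤ n ^ e := by exact_mod_cast h1
    have h3 : (n : ℤ) ^ e ≤ (w : ℤ) ^ 4 := by
      nlinarith [sq_nonneg ((w : ℤ) ^ 2 - 2 * U ^ 2)]
    have h4 : n ^ e ≤ w ^ 4 := by exact_mod_cast h3
    have h5 : 2 ≤ n ^ (d - 1) := hn2.trans (Nat.le_self_pow (by omega) n)
    have h6 : 1 ≤ w ^ 4 := Nat.one_le_pow _ _ hw1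
    nlinarith
  · have hcn : c = (n : ℤ) := by omega
    have hcnR : (c : ℝ) = (n : ℝ) := by rw [hcn]; push_cast; ring
    rw [hcnR] at hpow
    rw [hcn] at heq
    obtain ⟨V, hV⟩ : ∃ V : ℕ, V = U.natAbs := ⟨_, rfl⟩
    have hVU : U ^ 2 = (V : ℤ) ^ 2 := by rw [hV]; simp
    rw [hVU] at heq
    have hne : 0 < (n : ℤ) ^ e := by positivity
    have hwV : w < V := by
      by_contra hcon
      push Not at hcon
      have h1 : (V : ℤ) ^ 2 ≤ (w : ℤ) ^ 2 := by gcongr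
      have h2 : 0 ≤ (V : ℤ) ^ 2 := by positivity
      nlinarith
    have heqN : 4 * V ^ 2 * ((V - w) * (V + w)) = n ^ e := by
      zify [hwV.le]
      rw [← heq]; ring
    have hwb : 4 ≤ n → w ^ 4 * n ^ (d - 1) ≤ 2 * n ^ e := by
      intro h4
      have hcR : (4 : ℝ) ≤ n := by exact_mod_cast h4
      have hy := seqY_pos d hd4 c (by omega) k
      have hyd := y_pow_le_two d hd4 c _ (by rw [hcnR]; exact hcR) (by linarith [hy.1]) hy.2
      have h0 : 0 < (n : ℝ) ^ e := by positivity
      have := mul_le_mul_of_nonneg_right hyd h0.le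
      have h1 : (w : ℝ) ^ 4 * (n : ℝ) ^ (d - 1) ≤ 2 * (n : ℝ) ^ e := by linarith
      exact_mod_cast h1
    rcases Nat.even_or_odd V with hVe | hVo
    · refine even_case V w n e heo he3 hw1 hwV hcopn hVe heqN fun h4 => ?_
      refine le_trans ?_ (hwb h4)
      gcongr
      · omega
      · omega
    · obtain ⟨σ, p, Q, z, hσo, hσ3, hp, hQ, hQe, hcQ, hz, hzS, h1, h2⟩ :=
        odd_case V w n e heo he3 hw1 hwV hcopn hVo heqN
      have hc18 : 18 ≤ n := by
        obtain ⟨m, hm⟩ := hQe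
        have : 1 * 2 ≤ p * Q := Nat.mul_le_mul hp (by omega)
        rw [hcQ]; nlinarith
      rcases Nat.eq_zero_or_pos q with hq0 | hq0
      · have hd44 : d = 4 := by rw [hd4q, hq0]; norm_num
        rcases Nat.eq_zero_or_pos k with hk0 | hk0
        · have he33 : e = 3 := by rw [he, hd44, hk0]; norm_num
          have hA1 : A = 1 := by rw [hA, hk0]; rfl
          have hw1' : w = 1 := by rw [hw, hA1]; simp
          rw [hw1'] at hz
          rw [he33] at h2
          exact small_case σ Q z hσ3 (by rw [hz]; norm_num) h2
        · have he15 : 15 ≤ e := by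
            rw [he, hd44]
            have : 4 ^ 2 ≤ 4 ^ (k + 1) := Nat.pow_le_pow_right (by norm_num) (by omega)
            omega
          have h3e : 3 ∣ e := by
            rw [he, hd44]
            have := Nat.sub_dvd_pow_sub_pow 4 1 (k + 1)
            simpa using this
          have hy := seqY_pos d hd4 c (by omega) k
          have hcR : (18 : ℝ) ≤ n := by exact_mod_cast hc18
          have h43 : d - 1 = 3 := by omega
          rw [h43, hcnR] at hy
          rw [h43, show seqY d c k ^ d = seqY d c k ^ 4 by rw [hd44]] at hpow
          exact hard e he15 h3e σ p Q n z w (seqY d c k ^ 4) hσ3 hp hQ hQe hcQ hz hzS h1 h2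
            (one_le_pow₀ hy.1) (Y_bound n _ hcR hy.1 hy.2) hpow
      · have hd8 : 8 ≤ d := by
          have : 2 ^ 1 ≤ 2 ^ q := Nat.pow_le_pow_right (by norm_num) hq0
          omega
        refine mid_case e he3 σ p Q n z w hσo hσ3 hp hQ hQe hcQ hz hzS h1 h2 ?_
        refine le_trans ?_ (hwb (by omega))
        gcongr
        · omega
        · omega

theorem int_of_quartic (W N : ℤ) (U : ℚ) (h : 4 * U ^ 2 * (U ^ 2 - W) = N) : ∃ m : ℤ, U = m := by
  have hint : IsIntegral ℤ (2 * U) := by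
    refine ⟨X ^ 4 + (C (-4 * W) * X ^ 2 + C (-4 * N)), ?_, ?_⟩
    · apply monic_X_pow_add
      compute_degree!
    · simp only [eval₂_add, eval₂_mul, eval₂_pow, eval₂_X, eval₂_C]
      simp only [eq_intCast, Int.cast_mul, Int.cast_neg, Int.cast_ofNat]
      rw [← h]; ring
  obtain ⟨V, hV⟩ := IsIntegrallyClosed.isIntegral_iff.1 hint
  have hV' : (V : ℚ) = 2 * U := by simpa using hV
  have hVeq : V ^ 4 = 4 * W * V ^ 2 + 4 * N := by
    have : (V : ℚ) ^ 4 = 4 * W * V ^ 2 + 4 * N := by rw [hV', ← h]; ring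
    exact_mod_cast this
  have h2 : (2 : ℤ) ∣ V := by
    apply Int.prime_two.dvd_of_dvd_pow (n := 4)
    rw [hVeq]
    exact ⟨2 * W * V ^ 2 + 2 * N, by ring⟩
  obtain ⟨m, hm⟩ := h2
  refine ⟨m, ?_⟩
  rw [hm] at hV'
  push_cast at hV'
  linarith

/-- orbit -/
def seqX (d : ℕ) (b : ℚ) : ℕ → ℚ
  | 0 => b
  | k + 1 => seqX d b k ^ d + b

theorem seqX_A (d : ℕ) (hd : 4 ≤ d) (c : ℤ) (hc : c ≠ 0) (k : ℕ) :
    seqX d (1 / (c : ℚ)) k * (c : ℚ) ^ (d ^ k) = seqA d c k := by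
  have hcQ : (c : ℚ) ≠ 0 := by exact_mod_cast hc
  induction k with
  | zero => simp [seqX, seqA, hcQ]
  | succ k ih =>
    simp only [seqX, seqA]
    push_cast
    rw [← ih, mul_pow, ← pow_mul, ← pow_succ, add_mul]
    congr 1
    have h1 : d ^ (k + 1) = (d ^ (k + 1) - 1) + 1 := by
      have : 1 ≤ d ^ (k + 1) := Nat.one_le_pow _ _ (by omega)
      omega
    rw [h1, pow_succ, Nat.add_sub_cancel]
    field_simp

theorem core (r : ℕ) (hr : 2 ≤ r) (c : ℤ) (hc : c ≠ 0) (k : ℕ) (u v : ℚ) (huv : 2 * u * v = -1)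
    (h : u ^ 2 - (1 / (c : ℚ)) * v ^ 2 = seqX (2 ^ r) (1 / (c : ℚ)) k ^ (2 ^ (r - 1))) : False := by
  obtain ⟨d, hd⟩ : ∃ d, d = 2 ^ r := ⟨_, rfl⟩
  obtain ⟨q, hq⟩ : ∃ q, r = q + 2 := ⟨r - 2, by omega⟩
  have hd4q : d = 4 * 2 ^ q := by rw [hd, hq, pow_add]; ring
  have hq1 : 1 ≤ 2 ^ q := Nat.one_le_two_pow
  have hd4 : 4 ≤ d := by omega
  have hr1 : 2 ^ (r - 1) = d / 2 := by
    have : r - 1 = q + 1 := by omega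
    rw [this, pow_succ]; omega
  have hcQ : (c : ℚ) ≠ 0 := by exact_mod_cast hc
  rw [hr1, ← hd] at h
  have hA := seqX_A d hd4 c hc k
  obtain ⟨x, hx⟩ : ∃ x, x = seqX d (1 / (c : ℚ)) k := ⟨_, rfl⟩
  rw [← hx] at h hA
  obtain ⟨T, hT⟩ : ∃ T : ℚ, T = (c : ℚ) ^ (d ^ k * 2 ^ q) := ⟨_, rfl⟩
  have hTW : x ^ (d / 2) * T ^ 2 = ((seqA d c k ^ (d / 2) : ℤ) : ℚ) := by
    push_cast
    rw [← hA, mul_pow, hT, ← pow_mul, ← pow_mul]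
    congr 2
    rw [show d / 2 = 2 ^ q * 2 by omega, mul_assoc]
  have hT4 : T ^ 4 = (c : ℚ) ^ (d ^ (k + 1) - 1) * c := by
    have h1 : d ^ (k + 1) = (d ^ (k + 1) - 1) + 1 := by
      have : 1 ≤ d ^ (k + 1) := Nat.one_le_pow _ _ (by omega)
      omega
    rw [hT, ← pow_mul, ← pow_succ, ← h1, pow_succ]
    congr 1
    rw [mul_assoc]; congr 1; omega
  have hmain : 4 * (T * u) ^ 2 * ((T * u) ^ 2 - ((seqA d c k ^ (d / 2) : ℤ) : ℚ)) =
      ((c ^ (d ^ (k + 1) - 1) : ℤ) : ℚ) := by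
    rw [← hTW, ← h]
    have h2 : 4 * (T * u) ^ 2 * ((T * u) ^ 2 - (u ^ 2 - (1 / (c : ℚ)) * v ^ 2) * T ^ 2)
      = T ^ 4 * (2 * u * v) ^ 2 * (1 / c) := by ring
    rw [h2, huv, hT4]; push_cast; field_simp
  obtain ⟨m, hm⟩ := int_of_quartic _ _ _ hmain
  rw [hm] at hmain
  exact final_int r k hr d hd c hc m (by exact_mod_cast hmain)

/-- If `d = 2^r` with `r ≥ 2`, `c` a nonzero integer, and `f(z) = z^d + 1/c` is
irreducible over `ℚ`, then every iterate `fⁿ` (`n ≥ 1`) is irreducible over `ℚ`. -/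
theorem stmt2 (r : ℕ) (hr : 2 ≤ r) (d : ℕ) (hd : d = 2 ^ r) (c : ℤ) (hc : c ≠ 0)
    (f : ℚ[X]) (hf : f = X ^ d + C (1 / (c : ℚ))) (hirr : Irreducible f) :
    ∀ n : ℕ, 1 ≤ n → Irreducible ((f.comp ·)^[n] X) := by
  intro n hn
  obtain ⟨m, rfl⟩ : ∃ m, n = m + 1 := ⟨n - 1, by omega⟩
  have hcQ : (c : ℚ) ≠ 0 := by exact_mod_cast hc
  subst hf
  subst hd
  exact reduction r hr (1 / (c : ℚ)) (by simp [hcQ]) hirr (seqX (2 ^ r) (1 / (c : ℚ))) rfl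
    (fun k => rfl) (fun k u v => core r hr c hc k u v) m
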